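/- arXiv:1608.03878 — 2 statements merged into one kernel-verified Lean document; each statement's English description precedes it below -/
import Mathlib

section
/- Let ω : ℝ → ℝ be continuous on I = (−1,1) with ω(x) ≥ 1 for all x ∈ I and ∫_I ω dx < ∞. Let S ⊆ I be a finite set and let u : ℝ → ℝ be locally absolutely continuous on I∖S with a.e. derivative u′, such that at every x ∈ S the one-sided limits u(x⁻) and u(x⁺) exist and are distinct. Let (εₙ) be positive reals with εₙ → 0, and for each n let uₙ, vₙ : ℝ → ℝ be locally absolutely continuous on I with a.e. derivatives gₙ, hₙ, with 0 ≤ vₙ(x) ≤ 1 for x ∈ I, ∫_I |uₙ − u| ω dx → 0, and ∫_I |vₙ − 1| dx → 0. Then liminf_{n→∞} ( ∫_I vₙ² gₙ² ω dx + ∫_I [ (εₙ/2) hₙ² + (1/(2εₙ)) (vₙ − 1)² ] ω dx ) ≥ ∫_I |u′|² ω dx + Σ_{x ∈ S} ω(x), where all energy integrals are Lebesgue integrals with values in [0,∞]. -/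
open MeasureTheory Filter Set
open scoped ENNReal

/-- `f` is absolutely continuous on `[a, b]` with a.e. derivative `f'`, encoded via the
fundamental theorem of calculus for the Lebesgue integral. -/
def ACderivOn (f f' : ℝ → ℝ) (a b : ℝ) : Prop :=
  IntervalIntegrable f' volume a b ∧
    ∀ x ∈ Set.Icc a b, f x = f a + ∫ t in a..x, f' t

/-- `f` is locally absolutely continuous on the open set `U` with a.e. derivative `f'`:
it is absolutely continuous with derivative `f'` on every compact subinterval of `U`. -/
def LocACOn (f f' : ℝ → ℝ) (U : Set ℝ) : Prop :=
  ∀ a b : ℝ, a ≤ b → Set.Icc a b ⊆ U → ACderivOn f f' a b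

open scoped Topology

/-- The energy density of the weighted Ambrosio–Tortorelli functional with parameter `e`, where
`g` and `h` are the derivatives of the two phases `u` and `v`. -/
noncomputable def atDensity (ω : ℝ → ℝ) (e : ℝ) (v g h : ℝ → ℝ) (x : ℝ) : ℝ≥0∞ :=
  ENNReal.ofReal ((v x) ^ 2 * (g x) ^ 2 * ω x) +
    ENNReal.ofReal (((e / 2) * (h x) ^ 2 + (1 / (2 * e)) * (v x - 1) ^ 2) * ω x)

theorem ofReal_intervalIntegral_le_setLIntegral {φ : ℝ → ℝ} {F : ℝ → ℝ≥0∞} {a b : ℝ}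
    (hab : a ≤ b) (hφ : IntervalIntegrable φ volume a b)
    (hF : ∀ x ∈ Ioo a b, ENNReal.ofReal (φ x) ≤ F x) :
    ENNReal.ofReal (∫ x in a..b, φ x) ≤ ∫⁻ x in Ioo a b, F x := by
  rw [intervalIntegral.integral_of_le hab, integral_Ioc_eq_integral_Ioo]
  have hi : Integrable φ (volume.restrict (Ioo a b)) :=
    ((intervalIntegrable_iff_integrableOn_Ioc_of_le hab).1 hφ).mono_set Ioo_subset_Ioc_self
  calc ENNReal.ofReal (∫ x in Ioo a b, φ x)
      ≤ ENNReal.ofReal (∫ x in Ioo a b, max (φ x) 0) :=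
        ENNReal.ofReal_le_ofReal (integral_mono hi hi.pos_part fun x => le_max_left _ _)
    _ = ∫⁻ x in Ioo a b, ENNReal.ofReal (max (φ x) 0) :=
        ofReal_integral_eq_lintegral_ofReal hi.pos_part (ae_of_all _ fun x => le_max_right _ _)
    _ ≤ ∫⁻ x in Ioo a b, F x :=
        setLIntegral_mono' measurableSet_Ioo fun x hx => by
          simpa [ENNReal.ofReal_max] using hF x hx

namespace ACderivOn

variable {f f' : ℝ → ℝ} {a b : ℝ}

theorem integral_eq (hf : ACderivOn f f' a b) (hab : a ≤ b) :
    ∫ t in a..b, f' t = f b - f a := by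
  rw [hf.2 b (right_mem_Icc.2 hab)]; ring

theorem absolutelyContinuousOnInterval (hf : ACderivOn f f' a b) (hab : a ≤ b) :
    AbsolutelyContinuousOnInterval f a b := by
  have h1 := hf.1.absolutelyContinuousOnInterval_intervalIntegral (c := a) left_mem_uIcc
  have h2 : AbsolutelyContinuousOnInterval (fun _ : ℝ => f a) a b :=
    (LipschitzWith.const (f a)).lipschitzOnWith.absolutelyContinuousOnInterval
  have h3 := (absolutelyContinuousOnInterval_iff _ _ _).1 (h2.fun_add h1)
  refine (absolutelyContinuousOnInterval_iff _ _ _).2 fun ε hε => ?_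
  obtain ⟨δ, hδ, H⟩ := h3 ε hε
  refine ⟨δ, hδ, fun E hE hEδ => lt_of_eq_of_lt (Finset.sum_congr rfl fun i hi => ?_) (H E hE hEδ)⟩
  have hmem := hE.1 i hi
  rw [uIcc_of_le hab] at hmem
  rw [hf.2 _ hmem.1, hf.2 _ hmem.2]

theorem continuousOn (hf : ACderivOn f f' a b) (hab : a ≤ b) : ContinuousOn f (Icc a b) := by
  simpa [uIcc_of_le hab] using (hf.absolutelyContinuousOnInterval hab).continuousOn

theorem ae_hasDerivAt (hf : ACderivOn f f' a b) (hab : a ≤ b) :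
    ∀ᵐ x, x ∈ Ioo a b → HasDerivAt f (f' x) x := by
  filter_upwards [hf.1.ae_hasDerivAt_integral] with x hx hxab
  have h := (hx (by rw [uIcc_of_le hab]; exact Ioo_subset_Icc_self hxab) a left_mem_uIcc).const_add
    (f a)
  refine h.congr_of_eventuallyEq ?_
  filter_upwards [Ioo_mem_nhds hxab.1 hxab.2] with y hy
  exact hf.2 y (Ioo_subset_Icc_self hy)

theorem integral_mul_one_sub (hf : ACderivOn f f' a b) (hab : a ≤ b) :
    ∫ x in a..b, f' x * (1 - f x) = (f b - f b ^ 2 / 2) - (f a - f a ^ 2 / 2) := by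
  have hac := hf.absolutelyContinuousOnInterval hab
  have h1 := hac.integral_deriv_mul_eq_sub hac
  have h2 : ∫ x in a..b, deriv f x * f x + f x * deriv f x = ∫ x in a..b, 2 * (f' x * f x) := by
    apply intervalIntegral.integral_congr_ae
    have hb : ∀ᵐ x : ℝ, x ≠ b := by simp [ae_iff, measure_singleton]
    filter_upwards [hf.ae_hasDerivAt hab, hb] with x hx hxb hxI
    rw [uIoc_of_le hab] at hxI
    rw [(hx ⟨hxI.1, lt_of_le_of_ne hxI.2 hxb⟩).deriv]
    ring
  have hi : IntervalIntegrable (fun x => f' x * f x) volume a b :=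
    hf.1.mul_continuousOn hac.continuousOn
  rw [h2, intervalIntegral.integral_const_mul] at h1
  simp only [mul_sub, mul_one]
  rw [intervalIntegral.integral_sub hf.1 hi, hf.integral_eq hab]
  linarith

end ACderivOn

theorem ofReal_dip_le_setLIntegral_atDensity {ω v g h : ℝ → ℝ} {e m a b : ℝ} (hab : a ≤ b)
    (he : 0 < e) (hm : 0 ≤ m) (hω : ∀ x ∈ Ioo a b, m ≤ ω x) (hv : ACderivOn v h a b) :
    ENNReal.ofReal (m * |(v b - v b ^ 2 / 2) - (v a - v a ^ 2 / 2)|) ≤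
      ∫⁻ x in Ioo a b, atDensity ω e v g h x := by
  have key : ∀ σ : ℝ, |σ| = 1 →
      ENNReal.ofReal (m * (σ * ((v b - v b ^ 2 / 2) - (v a - v a ^ 2 / 2)))) ≤
      ∫⁻ x in Ioo a b, atDensity ω e v g h x := by
    intro σ hσ
    rw [← hv.integral_mul_one_sub hab, ← intervalIntegral.integral_const_mul,
      ← intervalIntegral.integral_const_mul]
    refine ofReal_intervalIntegral_le_setLIntegral hab ?_ fun x hx => ?_
    · have hc := (hv.absolutelyContinuousOnInterval hab).continuousOn
      exact ((hv.1.mul_continuousOn (continuousOn_const.sub hc)).const_mul _).const_mul _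
    · refine le_trans (ENNReal.ofReal_le_ofReal ?_) le_add_self
      have h2 : (e / 2) * (h x) ^ 2 + (1 / (2 * e)) * (v x - 1) ^ 2 - σ * (h x * (1 - v x)) =
          (e * h x - σ * (1 - v x)) ^ 2 / (2 * e) := by
        have : σ ^ 2 = 1 := by rw [← sq_abs, hσ, one_pow]
        field_simp
        linear_combination (v x - 1) ^ 2 * (-this)
      have h3 : 0 ≤ (e * h x - σ * (1 - v x)) ^ 2 / (2 * e) := by positivity
      have h4 : 0 ≤ (e / 2) * (h x) ^ 2 + (1 / (2 * e)) * (v x - 1) ^ 2 := by positivity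
      calc m * (σ * (h x * (1 - v x)))
          ≤ m * ((e / 2) * (h x) ^ 2 + (1 / (2 * e)) * (v x - 1) ^ 2) := by
            gcongr; linarith
        _ ≤ _ := by rw [mul_comm]; gcongr; exact hω x hx
  rcases abs_cases ((v b - v b ^ 2 / 2) - (v a - v a ^ 2 / 2)) with ⟨h0, -⟩ | ⟨h0, -⟩
  · simpa [h0] using key 1 (by simp)
  · simpa [h0] using key (-1) (by simp)

theorem ofReal_slope_le_setLIntegral_atDensity {ω u v g h : ℝ → ℝ} {e m θ a b : ℝ} (hab : a < b)
    (hm : 0 ≤ m) (hω : ∀ x ∈ Ioo a b, m ≤ ω x) (hu : ACderivOn u g a b)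
    (hθ : 0 ≤ θ) (hvθ : ∀ x ∈ Ioo a b, θ ≤ v x) :
    ENNReal.ofReal (m * (θ ^ 2 * (u b - u a) ^ 2 / (b - a))) ≤
      ∫⁻ x in Ioo a b, atDensity ω e v g h x := by
  have hba : 0 < b - a := sub_pos.2 hab
  set c := (u b - u a) / (b - a) with hc
  have hci : IntervalIntegrable (fun _ : ℝ => c ^ 2) volume a b := intervalIntegrable_const
  have hint : ∫ x in a..b, m * (θ ^ 2 * (2 * c * g x - c ^ 2)) =
      m * (θ ^ 2 * (u b - u a) ^ 2 / (b - a)) := by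
    rw [intervalIntegral.integral_const_mul, intervalIntegral.integral_const_mul,
      intervalIntegral.integral_sub (hu.1.const_mul _) hci, intervalIntegral.integral_const_mul,
      hu.integral_eq hab.le, intervalIntegral.integral_const, smul_eq_mul, hc]
    field_simp
    ring
  rw [← hint]
  refine ofReal_intervalIntegral_le_setLIntegral hab.le
    ((((hu.1.const_mul _).sub hci).const_mul _).const_mul _) fun x hx => ?_
  refine le_trans (ENNReal.ofReal_le_ofReal ?_) le_self_add
  calc m * (θ ^ 2 * (2 * c * g x - c ^ 2)) ≤ m * (θ ^ 2 * (g x) ^ 2) := by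
        gcongr; nlinarith [sq_nonneg (g x - c)]
    _ ≤ m * ((v x) ^ 2 * (g x) ^ 2) := by gcongr; exact hvθ x hx
    _ ≤ _ := by rw [mul_comm]; gcongr; exact hω x hx

/-- On an interval, either `v` stays above the threshold `θ` and the slope of `u` is paid for, or
`v` drops below `θ` and its transitions to and from the dip are paid for. -/
theorem ofReal_min_le_setLIntegral_atDensity {U : Set ℝ} {ω u v g h : ℝ → ℝ} {e m θ a b : ℝ}
    (hab : a < b) (hU : Icc a b ⊆ U) (he : 0 < e) (hm : 0 ≤ m) (hω : ∀ x ∈ Icc a b, m ≤ ω x)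
    (hu : LocACOn u g U) (hv : LocACOn v h U) (hv0 : ∀ x ∈ Icc a b, 0 ≤ v x)
    (hθ0 : 0 ≤ θ) (hθ1 : θ ≤ 1) :
    ENNReal.ofReal (m * min ((v a - v a ^ 2 / 2) + (v b - v b ^ 2 / 2) - 2 * (θ - θ ^ 2 / 2))
        (θ ^ 2 * (u b - u a) ^ 2 / (b - a))) ≤
      ∫⁻ x in Ioo a b, atDensity ω e v g h x := by
  by_cases hθ : ∀ x ∈ Ioo a b, θ ≤ v x
  · refine le_trans (ENNReal.ofReal_le_ofReal ?_) (ofReal_slope_le_setLIntegral_atDensity hab hm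
      (fun x hx => hω x (Ioo_subset_Icc_self hx)) (hu a b hab.le hU) hθ0 hθ)
    gcongr
    exact min_le_right _ _
  · push Not at hθ
    obtain ⟨r, ⟨har, hrb⟩, hr⟩ := hθ
    have h1 := ofReal_dip_le_setLIntegral_atDensity (g := g) har.le he hm
      (fun x hx => hω x ⟨hx.1.le, (hx.2.trans hrb).le⟩)
      (hv a r har.le ((Icc_subset_Icc_right hrb.le).trans hU))
    have h2 := ofReal_dip_le_setLIntegral_atDensity (g := g) hrb.le he hm
      (fun x hx => hω x ⟨(har.trans hx.1).le, hx.2.le⟩)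
      (hv r b hrb.le ((Icc_subset_Icc_left har.le).trans hU))
    have hd : Disjoint (Ioo a r) (Ioo r b) :=
      Set.disjoint_left.2 fun x hx hx' => lt_asymm hx.2 hx'.1
    calc _ ≤ ENNReal.ofReal (m * |(v r - v r ^ 2 / 2) - (v a - v a ^ 2 / 2)| +
          m * |(v b - v b ^ 2 / 2) - (v r - v r ^ 2 / 2)|) := by
          refine ENNReal.ofReal_le_ofReal ?_
          rw [← mul_add]
          refine mul_le_mul_of_nonneg_left ((min_le_left _ _).trans ?_) hm
          have h3 := neg_abs_le ((v r - v r ^ 2 / 2) - (v a - v a ^ 2 / 2))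
          have h4 := le_abs_self ((v b - v b ^ 2 / 2) - (v r - v r ^ 2 / 2))
          have h5 := hv0 r ⟨har.le, hrb.le⟩
          nlinarith [mul_nonneg (sub_nonneg.2 hr.le) (by linarith : (0 : ℝ) ≤ 2 - θ - v r)]
      _ ≤ _ := ENNReal.ofReal_add_le
      _ ≤ _ := add_le_add h1 h2
      _ = ∫⁻ x in Ioo a r ∪ Ioo r b, atDensity ω e v g h x :=
          (lintegral_union measurableSet_Ioo hd).symm
      _ ≤ _ := lintegral_mono_set (union_subset (Ioo_subset_Ioo_right hrb.le)
          (Ioo_subset_Ioo_left har.le))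

theorem IsOpen.exists_rat_Icc_subset {U : Set ℝ} (hU : IsOpen U) {x : ℝ} (hx : x ∈ U) :
    ∃ p q : ℚ, x ∈ Ioo (p : ℝ) q ∧ Icc (p : ℝ) q ⊆ U := by
  obtain ⟨δ, hδ, hball⟩ := Metric.isOpen_iff.1 hU x hx
  obtain ⟨p, hp1, hp2⟩ := exists_rat_btwn (sub_lt_self x hδ)
  obtain ⟨q, hq1, hq2⟩ := exists_rat_btwn (lt_add_of_pos_right x hδ)
  refine ⟨p, q, ⟨hp2, hq1⟩, fun y hy => hball ?_⟩
  rw [Real.ball_eq_Ioo]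
  exact ⟨hp1.trans_le hy.1, hy.2.trans_lt hq2⟩

namespace LocACOn

variable {f f' : ℝ → ℝ} {U : Set ℝ}

theorem ae_hasDerivAt (hf : LocACOn f f' U) (hU : IsOpen U) :
    ∀ᵐ x, x ∈ U → HasDerivAt f (f' x) x := by
  have h : ∀ p q : ℚ, ∀ᵐ x, (p ≤ q ∧ Icc (p : ℝ) q ⊆ U) → x ∈ Ioo (p : ℝ) q →
      HasDerivAt f (f' x) x := by
    intro p q
    by_cases hpq : p ≤ q ∧ Icc (p : ℝ) q ⊆ U
    · have hpq' : (p : ℝ) ≤ q := by exact_mod_cast hpq.1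
      filter_upwards [(hf p q hpq' hpq.2).ae_hasDerivAt hpq'] with x hx _ using hx
    · exact ae_of_all _ fun x h => absurd h hpq
  filter_upwards [ae_all_iff.2 fun p => ae_all_iff.2 (h p)] with x hx hxU
  obtain ⟨p, q, hxpq, hpqU⟩ := hU.exists_rat_Icc_subset hxU
  exact hx p q ⟨by exact_mod_cast (hxpq.1.trans hxpq.2).le, hpqU⟩ hxpq

theorem continuousOn (hf : LocACOn f f' U) (hU : IsOpen U) : ContinuousOn f U := by
  intro x hx
  obtain ⟨p, q, hxpq, hpqU⟩ := hU.exists_rat_Icc_subset hx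
  have hle := (hxpq.1.trans hxpq.2).le
  exact (((hf p q hle hpqU).continuousOn hle).continuousAt
    (Icc_mem_nhds hxpq.1 hxpq.2)).continuousWithinAt

theorem aemeasurable (hf : LocACOn f f' U) (hU : IsOpen U) :
    AEMeasurable f' (volume.restrict U) := by
  have hUn : U = ⋃ i : {i : ℚ × ℚ // (i.1 : ℝ) ≤ i.2 ∧ Icc (i.1 : ℝ) i.2 ⊆ U},
      Ioc (i.1.1 : ℝ) i.1.2 := by
    refine Subset.antisymm (fun x hx => ?_)
      (iUnion_subset fun i => Ioc_subset_Icc_self.trans i.2.2)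
    obtain ⟨p, q, hxpq, hpqU⟩ := hU.exists_rat_Icc_subset hx
    exact mem_iUnion.2 ⟨⟨(p, q), (hxpq.1.trans hxpq.2).le, hpqU⟩, Ioo_subset_Ioc_self hxpq⟩
  rw [hUn, aemeasurable_iUnion_iff]
  exact fun i => (hf _ _ i.2.1 i.2.2).1.1.aestronglyMeasurable.aemeasurable

end LocACOn

theorem exists_mem_Ioo_of_ae {P : ℝ → Prop} {U : Set ℝ} (hP : ∀ᵐ x, x ∈ U → P x) {p q : ℝ}
    (hpq : p < q) (hU : Ioo p q ⊆ U) : ∃ x ∈ Ioo p q, P x := by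
  have h0 : volume (Ioo p q) ≠ 0 := by simp [hpq]
  obtain ⟨x, hx, hxP⟩ := (frequently_ae_mem_iff.2 h0 |>.and_eventually hP).exists
  exact ⟨x, hx, hxP (hU hx)⟩

theorem measurable_setLIntegral_Ioo_add {G : ℝ → ℝ≥0∞} (hG : Measurable G) (h : ℝ) :
    Measurable fun x => ∫⁻ y in Ioo x (x + h), G y := by
  have hs : MeasurableSet {p : ℝ × ℝ | p.1 < p.2 ∧ p.2 < p.1 + h} :=
    (measurableSet_lt measurable_fst measurable_snd).inter
      (measurableSet_lt measurable_snd (measurable_fst.add_const h))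
  have hm := ((hG.comp measurable_snd).indicator hs).lintegral_prod_right' (ν := volume)
  convert hm using 2 with x
  rw [← lintegral_indicator measurableSet_Ioo]
  rfl

theorem lintegral_setLIntegral_Ioo_add {G : ℝ → ℝ≥0∞} (hG : Measurable G) (h : ℝ) :
    ∫⁻ x, ∫⁻ y in Ioo x (x + h), G y = ENNReal.ofReal h * ∫⁻ y, G y := by
  have hs : MeasurableSet {p : ℝ × ℝ | p.1 < p.2 ∧ p.2 < p.1 + h} :=
    (measurableSet_lt measurable_fst measurable_snd).inter
      (measurableSet_lt measurable_snd (measurable_fst.add_const h))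
  have hm := (hG.comp measurable_snd).indicator hs
  calc ∫⁻ x, ∫⁻ y in Ioo x (x + h), G y
      = ∫⁻ x, ∫⁻ y, {p : ℝ × ℝ | p.1 < p.2 ∧ p.2 < p.1 + h}.indicator (G ∘ Prod.snd) (x, y) := by
        refine lintegral_congr fun x => ?_
        rw [← lintegral_indicator measurableSet_Ioo]
        rfl
    _ = ∫⁻ y, ∫⁻ x, {p : ℝ × ℝ | p.1 < p.2 ∧ p.2 < p.1 + h}.indicator (G ∘ Prod.snd) (x, y) :=
        lintegral_lintegral_swap hm.aemeasurable
    _ = ∫⁻ y, ∫⁻ _ in Ioo (y - h) y, G y := by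
        refine lintegral_congr fun y => ?_
        rw [← lintegral_indicator measurableSet_Ioo]
        refine lintegral_congr fun x => ?_
        by_cases hx : x < y ∧ y < x + h
        · rw [indicator_of_mem (show (x, y) ∈ _ from hx),
            indicator_of_mem (show x ∈ Ioo (y - h) y from ⟨by linarith, hx.1⟩)]
          rfl
        · rw [indicator_of_notMem (show (x, y) ∉ _ from hx), indicator_of_notMem]
          exact fun hx' => hx ⟨hx'.2, by linarith [hx'.1]⟩
    _ = ENNReal.ofReal h * ∫⁻ y, G y := by
        simp [lintegral_mul_const _ hG, mul_comm]

/-- The standing assumptions on the weight and on an admissible sequence for the weighted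
Ambrosio–Tortorelli functionals on the open set `U`. -/
structure ATSequence (U : Set ℝ) (ω : ℝ → ℝ) (ε : ℕ → ℝ) (un gn vn hn : ℕ → ℝ → ℝ) : Prop where
  isOpen : IsOpen U
  weight_continuousOn : ContinuousOn ω U
  weight_pos : ∀ x ∈ U, 0 < ω x
  eps_pos : ∀ n, 0 < ε n
  locACOn_fst : ∀ n, LocACOn (un n) (gn n) U
  locACOn_snd : ∀ n, LocACOn (vn n) (hn n) U
  snd_nonneg : ∀ n, ∀ x ∈ U, 0 ≤ vn n x

/-- Pointwise convergence of the two phases to `u` and `1`. -/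
def ATTendstoAt (un vn : ℕ → ℝ → ℝ) (u : ℝ → ℝ) (x : ℝ) : Prop :=
  Tendsto (fun n => un n x) atTop (𝓝 (u x)) ∧ Tendsto (fun n => vn n x) atTop (𝓝 1)

namespace ATSequence

variable {U : Set ℝ} {ω : ℝ → ℝ} {ε : ℕ → ℝ} {un gn vn hn : ℕ → ℝ → ℝ} {u : ℝ → ℝ}

theorem aemeasurable_bulk (H : ATSequence U ω ε un gn vn hn) (n : ℕ) :
    AEMeasurable (fun x => ENNReal.ofReal ((vn n x) ^ 2 * (gn n x) ^ 2 * ω x))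
      (volume.restrict U) := by
  have hω := H.weight_continuousOn.aemeasurable (μ := volume) H.isOpen.measurableSet
  have hv := ((H.locACOn_snd n).continuousOn H.isOpen).aemeasurable (μ := volume)
    H.isOpen.measurableSet
  have hg := (H.locACOn_fst n).aemeasurable H.isOpen
  exact (((hv.pow_const 2).mul (hg.pow_const 2)).mul hω).ennreal_ofReal

theorem aemeasurable_atDensity (H : ATSequence U ω ε un gn vn hn) (n : ℕ) :
    AEMeasurable (atDensity ω (ε n) (vn n) (gn n) (hn n)) (volume.restrict U) := by
  have hω := H.weight_continuousOn.aemeasurable (μ := volume) H.isOpen.measurableSet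
  have hv := ((H.locACOn_snd n).continuousOn H.isOpen).aemeasurable (μ := volume)
    H.isOpen.measurableSet
  have hh := (H.locACOn_snd n).aemeasurable H.isOpen
  exact (H.aemeasurable_bulk n).add ((((hh.pow_const 2).const_mul _).add
    (((hv.sub_const 1).pow_const 2).const_mul _)).mul hω).ennreal_ofReal

theorem ofReal_min_le_liminf (H : ATSequence U ω ε un gn vn hn) {a b m θ : ℝ} (hab : a < b)
    (hU : Icc a b ⊆ U) (hm : 0 ≤ m) (hω : ∀ x ∈ Icc a b, m ≤ ω x)
    (ha : ATTendstoAt un vn u a) (hb : ATTendstoAt un vn u b) (hθ0 : 0 ≤ θ) (hθ1 : θ ≤ 1) :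
    ENNReal.ofReal (m * min ((1 - θ) ^ 2) (θ ^ 2 * (u b - u a) ^ 2 / (b - a))) ≤
      liminf (fun n => ∫⁻ x in Ioo a b, atDensity ω (ε n) (vn n) (gn n) (hn n) x) atTop := by
  have hlim : Tendsto (fun n => ENNReal.ofReal (m * min
      ((vn n a - vn n a ^ 2 / 2) + (vn n b - vn n b ^ 2 / 2) - 2 * (θ - θ ^ 2 / 2))
      (θ ^ 2 * (un n b - un n a) ^ 2 / (b - a)))) atTop
      (𝓝 (ENNReal.ofReal (m * min
        ((1 - 1 ^ 2 / 2) + (1 - 1 ^ 2 / 2) - 2 * (θ - θ ^ 2 / 2))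
        (θ ^ 2 * (u b - u a) ^ 2 / (b - a))))) :=
    ENNReal.tendsto_ofReal ((Tendsto.min
      (((ha.2.sub ((ha.2.pow 2).div_const 2)).add (hb.2.sub ((hb.2.pow 2).div_const 2))).sub_const _)
      ((((hb.1.sub ha.1).pow 2).const_mul _).div_const _)).const_mul m)
  have hθ : (1 - θ) ^ 2 = (1 - 1 ^ 2 / 2) + (1 - 1 ^ 2 / 2) - 2 * (θ - θ ^ 2 / 2) := by ring
  rw [hθ, ← hlim.liminf_eq]
  exact liminf_le_liminf (Eventually.of_forall fun n =>
    ofReal_min_le_setLIntegral_atDensity hab hU (H.eps_pos n) hm hω (H.locACOn_fst n)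
      (H.locACOn_snd n) (fun x hx => H.snd_nonneg n x (hU hx)) hθ0 hθ1)

/-- A jump of the limit costs at least the weight at the jump point. -/
theorem ofReal_weight_le_liminf (H : ATSequence U ω ε un gn vn hn) {W : Set ℝ} (hW : IsOpen W)
    (hWU : W ⊆ U) {x₀ l r : ℝ} (hx₀ : x₀ ∈ W) (hl : Tendsto u (𝓝[<] x₀) (𝓝 l))
    (hr : Tendsto u (𝓝[>] x₀) (𝓝 r)) (hlr : l ≠ r)
    (hae : ∀ᵐ x, x ∈ U → ATTendstoAt un vn u x) :
    ENNReal.ofReal (ω x₀) ≤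
      liminf (fun n => ∫⁻ x in W, atDensity ω (ε n) (vn n) (gn n) (hn n) x) atTop := by
  have hω0 : 0 < ω x₀ := H.weight_pos x₀ (hWU hx₀)
  have key : ∀ θ ∈ Ioo (0 : ℝ) 1, ENNReal.ofReal ((1 - θ) * ω x₀ * (1 - θ) ^ 2) ≤
      liminf (fun n => ∫⁻ x in W, atDensity ω (ε n) (vn n) (gn n) (hn n) x) atTop := by
    rintro θ ⟨hθ0, hθ1⟩
    have hd : 0 < |r - l| := abs_pos.2 (sub_ne_zero.2 hlr.symm)
    set d := |r - l|
    have hev : ∀ᶠ x in 𝓝 x₀, x ∈ W ∧ (1 - θ) * ω x₀ ≤ ω x := by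
      have hc := H.weight_continuousOn.continuousAt (H.isOpen.mem_nhds (hWU hx₀))
      filter_upwards [hW.mem_nhds hx₀, hc.eventually (lt_mem_nhds
        (show (1 - θ) * ω x₀ < ω x₀ by nlinarith))] with x h1 h2 using ⟨h1, h2.le⟩
    obtain ⟨δ, hδ, hball⟩ := Metric.eventually_nhds_iff.1 hev
    have hη : 0 < θ ^ 2 * (d / 2) ^ 2 / 2 := by positivity
    have hnear : ∀ᶠ x in 𝓝 x₀, dist x x₀ < min δ (θ ^ 2 * (d / 2) ^ 2 / 2) :=
      Metric.ball_mem_nhds x₀ (lt_min hδ hη)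
    have hl' := (hl.eventually (Metric.ball_mem_nhds l (by positivity : 0 < d / 4))).and
      (nhdsWithin_le_nhds hnear)
    have hr' := (hr.eventually (Metric.ball_mem_nhds r (by positivity : 0 < d / 4))).and
      (nhdsWithin_le_nhds hnear)
    obtain ⟨p, hp, hpl⟩ := (mem_nhdsLT_iff_exists_Ioo_subset).1 hl'
    obtain ⟨q, hq, hqr⟩ := (mem_nhdsGT_iff_exists_Ioo_subset).1 hr'
    have hmemU : ∀ x, dist x x₀ < δ → x ∈ U := fun x hx => hWU (hball hx).1
    obtain ⟨a, ha, haT⟩ := exists_mem_Ioo_of_ae hae hp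
      fun x hx => hmemU x ((hpl hx).2.trans_le (min_le_left _ _))
    obtain ⟨b, hb, hbT⟩ := exists_mem_Ioo_of_ae hae hq
      fun x hx => hmemU x ((hqr hx).2.trans_le (min_le_left _ _))
    have hab : a < b := ha.2.trans hb.1
    obtain ⟨ha1, ha2⟩ := hpl ha
    obtain ⟨hb1, hb2⟩ := hqr hb
    rw [lt_min_iff, Real.dist_eq, abs_of_neg (sub_neg.2 ha.2)] at ha2
    rw [lt_min_iff, Real.dist_eq, abs_of_pos (sub_pos.2 hb.1)] at hb2
    have hsub : ∀ x ∈ Icc a b, x ∈ W ∧ (1 - θ) * ω x₀ ≤ ω x := fun x hx => hball (by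
      rw [Real.dist_eq, abs_lt]
      constructor <;> linarith [hx.1, hx.2])
    have hju : d / 2 ≤ |u b - u a| := by
      rw [Real.dist_eq] at ha1 hb1
      have h1 : r - l = (u b - u a) - (u b - r) + (u a - l) := by ring
      have h2 := abs_add_le ((u b - u a) - (u b - r)) (u a - l)
      have h3 := abs_sub (u b - u a) (u b - r)
      rw [← h1] at h2
      linarith
    have hmin : (1 - θ) ^ 2 ≤ θ ^ 2 * (u b - u a) ^ 2 / (b - a) := by
      rw [le_div_iff₀ (sub_pos.2 hab)]
      have h1 : (d / 2) ^ 2 ≤ (u b - u a) ^ 2 := by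
        rw [← sq_abs (u b - u a)]; gcongr
      have h2 : (1 - θ) ^ 2 ≤ 1 := by nlinarith
      have h3 : θ ^ 2 * (d / 2) ^ 2 ≤ θ ^ 2 * (u b - u a) ^ 2 := by gcongr
      nlinarith [sub_pos.2 hab]
    have h := H.ofReal_min_le_liminf hab (fun x hx => hWU (hsub x hx).1)
      (mul_nonneg (sub_nonneg.2 hθ1.le) hω0.le) (fun x hx => (hsub x hx).2) haT hbT hθ0.le hθ1.le
    rw [min_eq_left hmin] at h
    exact h.trans (liminf_le_liminf (Eventually.of_forall fun n =>
      lintegral_mono_set fun x hx => (hsub x (Ioo_subset_Icc_self hx)).1))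
  have hlim : Tendsto (fun θ : ℝ => ENNReal.ofReal ((1 - θ) * ω x₀ * (1 - θ) ^ 2)) (𝓝[>] 0)
      (𝓝 (ENNReal.ofReal (ω x₀))) := by
    have hc : Continuous fun θ : ℝ => ENNReal.ofReal ((1 - θ) * ω x₀ * (1 - θ) ^ 2) :=
      ENNReal.continuous_ofReal.comp (by fun_prop)
    simpa using (hc.tendsto 0).mono_left nhdsWithin_le_nhds
  refine le_of_tendsto hlim ?_
  filter_upwards [Ioo_mem_nhdsGT (zero_lt_one' ℝ)] with θ hθ using key θ hθ

/-- The averaged energies on cells of length `1 / (j + 1)` asymptotically dominate the limit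
density at points of differentiability. -/
theorem ofReal_sq_deriv_le_liminf_liminf (H : ATSequence U ω ε un gn vn hn) {O : Set ℝ}
    (hO : IsOpen O) (hOU : O ⊆ U) {x d : ℝ} (hx : x ∈ O) (hd : HasDerivAt u d x)
    (hxT : ATTendstoAt un vn u x)
    (hxjT : ∀ j : ℕ, x + 1 / ((j : ℝ) + 1) ∈ U → ATTendstoAt un vn u (x + 1 / ((j : ℝ) + 1))) :
    ENNReal.ofReal (d ^ 2 * ω x) ≤ liminf (fun j : ℕ => liminf (fun n =>
      ENNReal.ofReal ((j : ℝ) + 1) * ∫⁻ y in Ioo x (x + 1 / ((j : ℝ) + 1)),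
        O.indicator (atDensity ω (ε n) (vn n) (gn n) (hn n)) y) atTop) atTop := by
  have hω0 : 0 < ω x := H.weight_pos x (hOU hx)
  have hstep : Tendsto (fun j : ℕ => x + 1 / ((j : ℝ) + 1)) atTop (𝓝 x) := by
    simpa using tendsto_one_div_add_atTop_nhds_zero_nat.const_add x
  have hslope : Tendsto (fun j : ℕ => ((j : ℝ) + 1) * (u (x + 1 / ((j : ℝ) + 1)) - u x)) atTop
      (𝓝 d) := by
    have h := hd.tendsto_slope.comp (tendsto_nhdsWithin_iff.2 ⟨hstep, Eventually.of_forall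
      fun j => by simp only [mem_compl_iff, mem_singleton_iff]; intro h; field_simp at h; linarith⟩)
    refine h.congr fun j => ?_
    simp [slope_def_field, div_eq_mul_inv, mul_comm]
  have key : ∀ θ ∈ Ioo (0 : ℝ) 1, ENNReal.ofReal (θ * ω x * (θ ^ 2 * d ^ 2)) ≤
      liminf (fun j : ℕ => liminf (fun n =>
      ENNReal.ofReal ((j : ℝ) + 1) * ∫⁻ y in Ioo x (x + 1 / ((j : ℝ) + 1)),
        O.indicator (atDensity ω (ε n) (vn n) (gn n) (hn n)) y) atTop) atTop := by
    rintro θ ⟨hθ0, hθ1⟩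
    have hlim : Tendsto (fun j : ℕ => ENNReal.ofReal (θ * ω x *
        (θ ^ 2 * (((j : ℝ) + 1) * (u (x + 1 / ((j : ℝ) + 1)) - u x)) ^ 2))) atTop
        (𝓝 (ENNReal.ofReal (θ * ω x * (θ ^ 2 * d ^ 2)))) :=
      ENNReal.tendsto_ofReal (((hslope.pow 2).const_mul _).const_mul _)
    rw [← hlim.liminf_eq]
    refine liminf_le_liminf ?_
    have hev : ∀ᶠ y in 𝓝 x, y ∈ O ∧ θ * ω x ≤ ω y := by
      have hc := H.weight_continuousOn.continuousAt (H.isOpen.mem_nhds (hOU hx))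
      filter_upwards [hO.mem_nhds hx, hc.eventually (lt_mem_nhds
        (show θ * ω x < ω x by nlinarith))] with y h1 h2 using ⟨h1, h2.le⟩
    obtain ⟨δ, hδ, hball⟩ := Metric.eventually_nhds_iff.1 hev
    have hlt := ((hslope.pow 2).const_mul (θ ^ 2)).eventually (gt_mem_nhds (lt_add_one _))
    have hgt : Tendsto (fun j : ℕ => ((j : ℝ) + 1) * (1 - θ) ^ 2) atTop atTop :=
      (tendsto_natCast_atTop_atTop.atTop_add tendsto_const_nhds).atTop_mul_const
        (pow_pos (sub_pos.2 hθ1) 2)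
    filter_upwards [hlt, hgt.eventually_ge_atTop (θ ^ 2 * d ^ 2 + 1),
      hstep.eventually (Metric.ball_mem_nhds x hδ)] with j h1 h2 h3
    have hj : (0 : ℝ) < (j : ℝ) + 1 := by positivity
    have hab : x < x + 1 / ((j : ℝ) + 1) := lt_add_of_pos_right x (by positivity)
    rw [Real.dist_eq, abs_of_pos (sub_pos.2 hab)] at h3
    have hsub : ∀ y ∈ Icc x (x + 1 / ((j : ℝ) + 1)), y ∈ O ∧ θ * ω x ≤ ω y := fun y hy =>
      hball (by rw [Real.dist_eq, abs_lt]; constructor <;> linarith [hy.1, hy.2])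
    have hcell := H.ofReal_min_le_liminf hab (fun y hy => hOU (hsub y hy).1)
      (mul_nonneg hθ0.le hω0.le) (fun y hy => (hsub y hy).2) hxT
      (hxjT j (hOU (hsub _ (right_mem_Icc.2 hab.le)).1)) hθ0.le hθ1.le
    have hquot : θ ^ 2 * (u (x + 1 / ((j : ℝ) + 1)) - u x) ^ 2 / (x + 1 / ((j : ℝ) + 1) - x) =
        ((j : ℝ) + 1) * (θ ^ 2 * (u (x + 1 / ((j : ℝ) + 1)) - u x) ^ 2) := by
      rw [add_sub_cancel_left]; field_simp
    have hmin : θ ^ 2 * (u (x + 1 / ((j : ℝ) + 1)) - u x) ^ 2 / (x + 1 / ((j : ℝ) + 1) - x) ≤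
        (1 - θ) ^ 2 := by
      rw [hquot]
      refine le_of_mul_le_mul_left ?_ hj
      calc _ = θ ^ 2 * (((j : ℝ) + 1) * (u (x + 1 / ((j : ℝ) + 1)) - u x)) ^ 2 := by ring
        _ ≤ _ := h1.le.trans h2
    rw [min_eq_right hmin, hquot] at hcell
    have hmono : Monotone fun t : ℝ≥0∞ => ENNReal.ofReal ((j : ℝ) + 1) * t :=
      fun s t hst => mul_le_mul_right hst _
    have hcont : Continuous fun t : ℝ≥0∞ => ENNReal.ofReal ((j : ℝ) + 1) * t :=
      ENNReal.continuous_const_mul ENNReal.ofReal_ne_top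
    calc _ = ENNReal.ofReal ((j : ℝ) + 1) * ENNReal.ofReal (θ * ω x *
          (((j : ℝ) + 1) * (θ ^ 2 * (u (x + 1 / ((j : ℝ) + 1)) - u x) ^ 2))) := by
          rw [← ENNReal.ofReal_mul hj.le]; congr 1; ring
      _ ≤ _ := hmono hcell
      _ = _ := hmono.map_liminf_of_continuousAt _ hcont.continuousAt
      _ = _ := by
          refine liminf_congr (Eventually.of_forall fun n => ?_)
          simp only [Function.comp]
          congr 1
          refine setLIntegral_congr_fun measurableSet_Ioo fun y hy => ?_
          rw [indicator_of_mem (hsub y (Ioo_subset_Icc_self hy)).1]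
  have hlim : Tendsto (fun θ : ℝ => ENNReal.ofReal (θ * ω x * (θ ^ 2 * d ^ 2))) (𝓝[<] 1)
      (𝓝 (ENNReal.ofReal (d ^ 2 * ω x))) := by
    have hc : Continuous fun θ : ℝ => ENNReal.ofReal (θ * ω x * (θ ^ 2 * d ^ 2)) :=
      ENNReal.continuous_ofReal.comp (by fun_prop)
    simpa [mul_comm] using (hc.tendsto 1).mono_left nhdsWithin_le_nhds
  refine le_of_tendsto hlim ?_
  filter_upwards [Ioo_mem_nhdsLT (zero_lt_one' ℝ)] with θ hθ using key θ hθ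

/-- Lower bound for the energies on an open set where the limit is differentiable a.e. -/
theorem setLIntegral_sq_deriv_le_liminf (H : ATSequence U ω ε un gn vn hn) {O : Set ℝ}
    (hO : IsOpen O) (hOU : O ⊆ U) {u' : ℝ → ℝ} (hu : ∀ᵐ x, x ∈ O → HasDerivAt u (u' x) x)
    (hae : ∀ᵐ x, x ∈ U → ATTendstoAt un vn u x) :
    ∫⁻ x in O, ENNReal.ofReal ((u' x) ^ 2 * ω x) ≤
      liminf (fun n => ∫⁻ x in O, atDensity ω (ε n) (vn n) (gn n) (hn n) x) atTop := by
  have hF : ∀ n, AEMeasurable (O.indicator (atDensity ω (ε n) (vn n) (gn n) (hn n))) volume :=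
    fun n => (aemeasurable_indicator_iff hO.measurableSet).2
      ((H.aemeasurable_atDensity n).mono_measure (Measure.restrict_mono hOU le_rfl))
  choose G hG hFG using hF
  have hint : ∀ n, ∫⁻ x in O, atDensity ω (ε n) (vn n) (gn n) (hn n) x = ∫⁻ x, G n x := fun n => by
    rw [← lintegral_indicator hO.measurableSet, lintegral_congr_ae (hFG n)]
  have hΦ : ∀ (j n : ℕ) (x : ℝ), ENNReal.ofReal ((j : ℝ) + 1) *
      ∫⁻ y in Ioo x (x + 1 / ((j : ℝ) + 1)),
        O.indicator (atDensity ω (ε n) (vn n) (gn n) (hn n)) y =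
      ENNReal.ofReal ((j : ℝ) + 1) * ∫⁻ y in Ioo x (x + 1 / ((j : ℝ) + 1)), G n y := fun j n x => by
    rw [lintegral_congr_ae (ae_restrict_of_ae (hFG n))]
  have hmeas : ∀ j n : ℕ, Measurable fun x => ENNReal.ofReal ((j : ℝ) + 1) *
      ∫⁻ y in Ioo x (x + 1 / ((j : ℝ) + 1)), G n y := fun j n =>
    (measurable_setLIntegral_Ioo_add (hG n) _).const_mul _
  have htot : ∀ j n : ℕ, ∫⁻ x, ENNReal.ofReal ((j : ℝ) + 1) *
      ∫⁻ y in Ioo x (x + 1 / ((j : ℝ) + 1)), G n y = ∫⁻ x, G n x := fun j n => by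
    have hj : (0 : ℝ) < (j : ℝ) + 1 := by positivity
    rw [lintegral_const_mul _ (measurable_setLIntegral_Ioo_add (hG n) _),
      lintegral_setLIntegral_Ioo_add (hG n), ← mul_assoc, ← ENNReal.ofReal_mul hj.le,
      mul_one_div_cancel hj.ne', ENNReal.ofReal_one, one_mul]
  have htrans : ∀ᵐ x, ∀ j : ℕ, x + 1 / ((j : ℝ) + 1) ∈ U →
      ATTendstoAt un vn u (x + 1 / ((j : ℝ) + 1)) :=
    ae_all_iff.2 fun j =>
      (measurePreserving_add_right volume (1 / ((j : ℝ) + 1))).quasiMeasurePreserving.ae hae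
  have hpt : ∀ᵐ x, x ∈ O → ENNReal.ofReal ((u' x) ^ 2 * ω x) ≤
      liminf (fun j : ℕ => liminf (fun n => ENNReal.ofReal ((j : ℝ) + 1) *
        ∫⁻ y in Ioo x (x + 1 / ((j : ℝ) + 1)), G n y) atTop) atTop := by
    filter_upwards [hu, hae, htrans] with x h1 h2 h3 hxO
    simpa only [hΦ] using H.ofReal_sq_deriv_le_liminf_liminf hO hOU hxO (h1 hxO) (h2 (hOU hxO)) h3
  calc ∫⁻ x in O, ENNReal.ofReal ((u' x) ^ 2 * ω x)
      ≤ ∫⁻ x in O, liminf (fun j : ℕ => liminf (fun n => ENNReal.ofReal ((j : ℝ) + 1) *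
        ∫⁻ y in Ioo x (x + 1 / ((j : ℝ) + 1)), G n y) atTop) atTop :=
        lintegral_mono_ae ((ae_restrict_iff' hO.measurableSet).2 hpt)
    _ ≤ ∫⁻ x, liminf (fun j : ℕ => liminf (fun n => ENNReal.ofReal ((j : ℝ) + 1) *
        ∫⁻ y in Ioo x (x + 1 / ((j : ℝ) + 1)), G n y) atTop) atTop :=
        setLIntegral_le_lintegral _ _
    _ ≤ liminf (fun j : ℕ => ∫⁻ x, liminf (fun n => ENNReal.ofReal ((j : ℝ) + 1) *
        ∫⁻ y in Ioo x (x + 1 / ((j : ℝ) + 1)), G n y) atTop) atTop :=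
        lintegral_liminf_le fun j => Measurable.liminf (hmeas j)
    _ ≤ liminf (fun j : ℕ => liminf (fun n => ∫⁻ x, ENNReal.ofReal ((j : ℝ) + 1) *
        ∫⁻ y in Ioo x (x + 1 / ((j : ℝ) + 1)), G n y) atTop) atTop :=
        liminf_le_liminf (Eventually.of_forall fun j => lintegral_liminf_le (hmeas j))
    _ = _ := by simp only [htot, hint, liminf_const]

end ATSequence

theorem ENNReal.liminf_add_liminf_le (f g : ℕ → ℝ≥0∞) :
    liminf f atTop + liminf g atTop ≤ liminf (fun n => f n + g n) atTop := by
  simp only [liminf_eq_iSup_iInf_of_nat]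
  rw [ENNReal.iSup_add_iSup_of_monotone
    (fun i j hij => biInf_mono fun k (hk : k ≥ j) => hij.trans hk)
    (fun i j hij => biInf_mono fun k (hk : k ≥ j) => hij.trans hk)]
  exact iSup_mono fun n => le_iInf₂ fun i hi => add_le_add (iInf₂_le i hi) (iInf₂_le i hi)

theorem ENNReal.sum_liminf_le {ι : Type*} (s : Finset ι) (f : ι → ℕ → ℝ≥0∞) :
    ∑ i ∈ s, liminf (f i) atTop ≤ liminf (fun n => ∑ i ∈ s, f i n) atTop := by
  classical
  induction s using Finset.induction_on with
  | empty => simp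
  | insert i s hi ih =>
    simp only [Finset.sum_insert hi]
    exact (add_le_add_right ih _).trans (ENNReal.liminf_add_liminf_le _ _)

/-- The liminf inequality along sequences converging almost everywhere. -/
theorem ATSequence.lintegral_add_sum_le_liminf {U : Set ℝ} {ω : ℝ → ℝ} {ε : ℕ → ℝ}
    {un gn vn hn : ℕ → ℝ → ℝ} {u u' : ℝ → ℝ} (H : ATSequence U ω ε un gn vn hn) {S : Set ℝ}
    (hS : S.Finite) (hSU : S ⊆ U) (hu : LocACOn u u' (U \ S))
    (hjump : ∀ x ∈ S, ∃ l r : ℝ, Tendsto u (𝓝[<] x) (𝓝 l) ∧ Tendsto u (𝓝[>] x) (𝓝 r) ∧ l ≠ r)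
    (hae : ∀ᵐ x, x ∈ U → ATTendstoAt un vn u x) :
    (∫⁻ x in U, ENNReal.ofReal ((u' x) ^ 2 * ω x)) +
        ∑ x ∈ hS.toFinset, ENNReal.ofReal (ω x) ≤
      liminf (fun n => ∫⁻ x in U, atDensity ω (ε n) (vn n) (gn n) (hn n) x) atTop := by
  obtain ⟨V, hV, hVd⟩ := hS.t2_separation
  set O : ℕ → Set ℝ := fun k => U ∩ ⋂ s ∈ S, {x | 1 / ((k : ℝ) + 1) < dist x s} with hO
  set W : ℕ → ℝ → Set ℝ := fun k s => U ∩ (V s ∩ Metric.ball s (1 / ((k : ℝ) + 1)))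
  have hOopen : ∀ k, IsOpen (O k) := fun k => H.isOpen.inter <| hS.isOpen_biInter fun s _ =>
    isOpen_lt continuous_const (continuous_id.dist continuous_const)
  have hWopen : ∀ k s, IsOpen (W k s) := fun k s =>
    H.isOpen.inter ((hV s).2.inter Metric.isOpen_ball)
  have hUS : IsOpen (U \ S) := H.isOpen.sdiff hS.isClosed
  have hmem : ∀ k x, x ∈ O k ↔ x ∈ U ∧ ∀ s ∈ S, 1 / ((k : ℝ) + 1) < dist x s := fun k x => by
    simp only [hO, mem_inter_iff, mem_iInter, mem_ofPred_eq]
  have hOS : ∀ k, O k ⊆ U \ S := fun k x hx => ⟨hx.1, fun hxS => by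
    have h := ((hmem k x).1 hx).2 x hxS
    rw [dist_self] at h
    exact absurd h (not_lt.2 (by positivity))⟩
  have hOmono : Monotone O := by
    intro k k' hk x hx
    refine (hmem k' x).2 ⟨hx.1, fun s hs => lt_of_le_of_lt ?_ (((hmem k x).1 hx).2 s hs)⟩
    have : (k : ℝ) ≤ k' := by exact_mod_cast hk
    gcongr
  have hOUn : ⋃ k, O k = U \ S := by
    refine Subset.antisymm (iUnion_subset hOS) fun x hx => ?_
    have h : ∀ᶠ k : ℕ in atTop, ∀ s ∈ S, 1 / ((k : ℝ) + 1) < dist x s :=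
      (eventually_all_finite hS).2 fun s hs =>
        (tendsto_one_div_add_atTop_nhds_zero_nat (𝕜 := ℝ)).eventually
          (gt_mem_nhds (dist_pos.2 (ne_of_mem_of_not_mem hs hx.2).symm))
    obtain ⟨k, hk⟩ := h.exists
    exact mem_iUnion.2 ⟨k, (hmem k x).2 ⟨hx.1, hk⟩⟩
  have hbulk : ∫⁻ x in U, ENNReal.ofReal ((u' x) ^ 2 * ω x) =
      ⨆ k, ∫⁻ x in O k, ENNReal.ofReal ((u' x) ^ 2 * ω x) := by
    rw [← setLIntegral_iUnion_of_directed _ hOmono.directed_le, hOUn]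
    exact setLIntegral_congr (sdiff_null_ae_eq_self (hS.measure_zero volume)).symm
  rw [hbulk, ENNReal.iSup_add]
  refine iSup_le fun k => ?_
  have h1 := H.setLIntegral_sq_deriv_le_liminf (hOopen k) ((hOS k).trans sdiff_subset)
    ((hu.ae_hasDerivAt hUS).mono fun x hx hxO => hx (hOS k hxO)) hae
  have h2 : ∀ s ∈ hS.toFinset, ENNReal.ofReal (ω s) ≤
      liminf (fun n => ∫⁻ x in W k s, atDensity ω (ε n) (vn n) (gn n) (hn n) x) atTop := by
    intro s hs
    have hsS := hS.mem_toFinset.1 hs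
    obtain ⟨l, r, hl, hr, hlr⟩ := hjump s hsS
    exact H.ofReal_weight_le_liminf (hWopen k s) inter_subset_left
      ⟨hSU hsS, (hV s).1, Metric.mem_ball_self (by positivity)⟩ hl hr hlr hae
  refine (add_le_add h1 ((Finset.sum_le_sum h2).trans (ENNReal.sum_liminf_le _ _))).trans
    ((ENNReal.liminf_add_liminf_le _ _).trans (liminf_le_liminf (Eventually.of_forall fun n => ?_)))
  have hWd : (hS.toFinset : Set ℝ).PairwiseDisjoint (W k) := by
    rw [hS.coe_toFinset]
    exact hVd.mono fun s => inter_subset_right.trans inter_subset_left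
  have hOW : Disjoint (O k) (⋃ s ∈ hS.toFinset, W k s) := by
    rw [Set.disjoint_left]
    intro x hx hxW
    obtain ⟨s, hs, hxs⟩ := mem_iUnion₂.1 hxW
    exact lt_asymm (((hmem k x).1 hx).2 s (hS.mem_toFinset.1 hs)) (Metric.mem_ball.1 hxs.2.2)
  rw [← lintegral_biUnion_finset hWd fun s _ => (hWopen k s).measurableSet,
    ← lintegral_union (Finset.measurableSet_biUnion _ fun s _ => (hWopen k s).measurableSet) hOW]
  exact lintegral_mono_set (union_subset inter_subset_left
    (iUnion₂_subset fun s _ => inter_subset_left))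

/-- Convergence of the integrals of the distances yields a.e. convergence of a subsequence. -/
theorem exists_seq_tendsto_ae_of_tendsto_lintegral_ofReal_abs {α : Type*} [MeasurableSpace α]
    {μ : Measure α} {f : ℕ → α → ℝ} {g : α → ℝ} (hf : ∀ n, AEMeasurable (f n) μ)
    (hg : AEMeasurable g μ)
    (h : Tendsto (fun n => ∫⁻ x, ENNReal.ofReal |f n x - g x| ∂μ) atTop (𝓝 0)) :
    ∃ ns : ℕ → ℕ, StrictMono ns ∧ ∀ᵐ x ∂μ, Tendsto (fun i => f (ns i) x) atTop (𝓝 (g x)) := by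
  refine TendstoInMeasure.exists_seq_tendsto_ae (tendstoInMeasure_of_tendsto_eLpNorm one_ne_zero
    (fun n => (hf n).aestronglyMeasurable) hg.aestronglyMeasurable ?_)
  simpa only [eLpNorm_one_eq_lintegral_enorm, Pi.sub_apply, Real.enorm_eq_ofReal_abs] using h

/-- Γ-liminf inequality for the one-dimensional weighted Ambrosio–Tortorelli functionals
with continuous weight `ω ≥ 1` on `I = (-1, 1)`. -/
theorem gamma_liminf_continuous_weight_1d
    (ω : ℝ → ℝ)
    (hωc : ContinuousOn ω (Set.Ioo (-1 : ℝ) 1))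
    (hω1 : ∀ x ∈ Set.Ioo (-1 : ℝ) 1, 1 ≤ ω x)
    (hωint : (∫⁻ x in Set.Ioo (-1 : ℝ) 1, ENNReal.ofReal (ω x)) < ⊤)
    (S : Set ℝ) (hS : S.Finite) (hSI : S ⊆ Set.Ioo (-1 : ℝ) 1)
    (u u' : ℝ → ℝ)
    (hu : LocACOn u u' (Set.Ioo (-1 : ℝ) 1 \ S))
    (hjump : ∀ x ∈ S, ∃ l r : ℝ,
      Tendsto u (nhdsWithin x (Set.Iio x)) (nhds l) ∧
      Tendsto u (nhdsWithin x (Set.Ioi x)) (nhds r) ∧ l ≠ r)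
    (ε : ℕ → ℝ) (hεpos : ∀ n, 0 < ε n) (hε0 : Tendsto ε atTop (nhds 0))
    (un gn vn hn : ℕ → ℝ → ℝ)
    (hunAC : ∀ n, LocACOn (un n) (gn n) (Set.Ioo (-1 : ℝ) 1))
    (hvnAC : ∀ n, LocACOn (vn n) (hn n) (Set.Ioo (-1 : ℝ) 1))
    (hv01 : ∀ n, ∀ x ∈ Set.Ioo (-1 : ℝ) 1, 0 ≤ vn n x ∧ vn n x ≤ 1)
    (huL1 : Tendsto (fun n => ∫⁻ x in Set.Ioo (-1 : ℝ) 1,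
      ENNReal.ofReal (|un n x - u x| * ω x)) atTop (nhds 0))
    (hvL1 : Tendsto (fun n => ∫⁻ x in Set.Ioo (-1 : ℝ) 1,
      ENNReal.ofReal |vn n x - 1|) atTop (nhds 0)) :
    (∫⁻ x in Set.Ioo (-1 : ℝ) 1, ENNReal.ofReal ((u' x) ^ 2 * ω x)) +
        ∑ x ∈ hS.toFinset, ENNReal.ofReal (ω x) ≤
      Filter.liminf (fun n =>
        (∫⁻ x in Set.Ioo (-1 : ℝ) 1,
          ENNReal.ofReal ((vn n x) ^ 2 * (gn n x) ^ 2 * ω x)) +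
        ∫⁻ x in Set.Ioo (-1 : ℝ) 1,
          ENNReal.ofReal (((ε n / 2) * (hn n x) ^ 2 +
            (1 / (2 * ε n)) * (vn n x - 1) ^ 2) * ω x)) atTop := by
  have hIo : IsOpen (Ioo (-1 : ℝ) 1) := isOpen_Ioo
  have H : ATSequence (Ioo (-1) 1) ω ε un gn vn hn :=
    ⟨hIo, hωc, fun x hx => one_pos.trans_le (hω1 x hx), hεpos, hunAC, hvnAC,
      fun n x hx => (hv01 n x hx).1⟩
  have hsum : ∀ n, (∫⁻ x in Ioo (-1 : ℝ) 1, ENNReal.ofReal ((vn n x) ^ 2 * (gn n x) ^ 2 * ω x)) +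
      (∫⁻ x in Ioo (-1 : ℝ) 1, ENNReal.ofReal (((ε n / 2) * (hn n x) ^ 2 +
        (1 / (2 * ε n)) * (vn n x - 1) ^ 2) * ω x)) =
      ∫⁻ x in Ioo (-1 : ℝ) 1, atDensity ω (ε n) (vn n) (gn n) (hn n) x :=
    fun n => (lintegral_add_left' (H.aemeasurable_bulk n) _).symm
  simp only [hsum]
  obtain ⟨φ, hφlim, hφ⟩ := exists_seq_tendsto_liminf (f := atTop)
    (u := fun n => ∫⁻ x in Ioo (-1 : ℝ) 1, atDensity ω (ε n) (vn n) (gn n) (hn n) x)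
  have huI : AEMeasurable u (volume.restrict (Ioo (-1 : ℝ) 1)) := by
    have hUS : IsOpen (Ioo (-1 : ℝ) 1 \ S) := hIo.sdiff hS.isClosed
    rw [← Measure.restrict_congr_set (sdiff_null_ae_eq_self (hS.measure_zero volume))]
    exact (hu.continuousOn hUS).aemeasurable hUS.measurableSet
  have huL1' : Tendsto (fun n => ∫⁻ x in Ioo (-1 : ℝ) 1, ENNReal.ofReal |un n x - u x|) atTop
      (𝓝 0) := by
    refine tendsto_of_tendsto_of_tendsto_of_le_of_le tendsto_const_nhds huL1 (fun _ => zero_le)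
      fun n => setLIntegral_mono' measurableSet_Ioo fun x hx => ENNReal.ofReal_le_ofReal ?_
    exact le_mul_of_one_le_right (abs_nonneg _) (hω1 x hx)
  obtain ⟨ψ, hψ, hψu⟩ := exists_seq_tendsto_ae_of_tendsto_lintegral_ofReal_abs
    (fun n => ((hunAC (φ n)).continuousOn hIo).aemeasurable measurableSet_Ioo) huI (huL1'.comp hφ)
  obtain ⟨χ, hχ, hχv⟩ := exists_seq_tendsto_ae_of_tendsto_lintegral_ofReal_abs
    (fun n => ((hvnAC (φ (ψ n))).continuousOn hIo).aemeasurable measurableSet_Ioo)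
    (aemeasurable_const (b := (1 : ℝ))) (hvL1.comp (hφ.comp hψ.tendsto_atTop))
  have Hsub : ATSequence (Ioo (-1) 1) ω (fun n => ε (φ (ψ (χ n)))) (fun n => un (φ (ψ (χ n))))
      (fun n => gn (φ (ψ (χ n)))) (fun n => vn (φ (ψ (χ n)))) (fun n => hn (φ (ψ (χ n)))) :=
    ⟨hIo, hωc, H.weight_pos, fun n => hεpos _, fun n => hunAC _, fun n => hvnAC _,
      fun n => H.snd_nonneg _⟩
  have hae : ∀ᵐ x, x ∈ Ioo (-1 : ℝ) 1 →
      ATTendstoAt (fun n => un (φ (ψ (χ n)))) (fun n => vn (φ (ψ (χ n)))) u x := by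
    refine (ae_restrict_iff' measurableSet_Ioo).1 ?_
    filter_upwards [hψu, hχv] with x h1 h2 using ⟨h1.comp hχ.tendsto_atTop, h2⟩
  refine (Hsub.lintegral_add_sum_le_liminf hS hSI hu hjump hae).trans_eq ?_
  exact (hφlim.comp (hψ.tendsto_atTop.comp hχ.tendsto_atTop)).liminf_eq
end

section
/- Let C ≥ 1 and let ω : ℝ → ℝ satisfy 1 ≤ ω(x) ≤ C for all x ∈ I = (−1,1); assume there is a finite set S_ω ⊆ I such that ω is continuous on I∖S_ω and at every x ∈ I the one-sided limits ω(x⁻) and ω(x⁺) exist, and set ω⁻(x) := min{ω(x⁻), ω(x⁺)}. Let S ⊆ I be a finite set and let u : ℝ → ℝ be bounded on I, locally absolutely continuous on I∖S with a.e. derivative u′ satisfying ∫_I |u′|² ω dx < ∞, and such that at every x ∈ S the one-sided limits u(x⁻) and u(x⁺) exist. Then for every sequence of positive reals εₙ → 0 there exist functions uₙ, vₙ : ℝ → ℝ, locally absolutely continuous on I with a.e. derivatives gₙ, hₙ, such that 0 ≤ vₙ ≤ 1 on I, ∫_I |uₙ − u| ω dx → 0, ∫_I |vₙ − 1| dx →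 0, and limsup_{n→∞} ( ∫_I vₙ² gₙ² ω dx + ∫_I [ (εₙ/2) hₙ² + (1/(2εₙ)) (vₙ − 1)² ] ω dx ) ≤ ∫_I |u′|² ω dx + Σ_{x ∈ S} ω⁻(x), where all energy integrals are Lebesgue integrals with values in [0,∞]. -/
open MeasureTheory Filter Set
open scoped ENNReal

theorem LipschitzWith.locACOn_deriv {f : ℝ → ℝ} {K : NNReal} (hf : LipschitzWith K f)
    (U : Set ℝ) : LocACOn f (deriv f) U := by
  intro a b _ _
  have hac (x : ℝ) : AbsolutelyContinuousOnInterval f a x :=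
    (hf.lipschitzOnWith (s := uIcc a x)).absolutelyContinuousOnInterval
  refine ⟨(hac b).intervalIntegrable_deriv, fun x _ => ?_⟩
  rw [(hac x).integral_deriv_eq_sub]
  ring

theorem lintegral_exp_neg_mul_abs_sub {b : ℝ} (hb : 0 < b) (c : ℝ) :
    ∫⁻ x, ENNReal.ofReal (Real.exp (-b * |x - c|)) = ENNReal.ofReal (2 / b) := by
  have h : ∫ x, Real.exp (-b * |x - c|) = 2 / b := by
    rw [integral_sub_right_eq_self (fun x => Real.exp (-b * |x|)) c,
      integral_comp_abs (f := fun x => Real.exp (-b * x)),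
      integral_exp_mul_Ioi (by linarith) 0]
    simp [div_eq_mul_inv]
  rw [← h, ofReal_integral_eq_lintegral_ofReal]
  · refine not_imp_comm.1 integral_undef ?_
    rw [h]
    positivity
  · exact Eventually.of_forall fun x => (Real.exp_pos _).le

/-- The optimal Ambrosio–Tortorelli phase field around finitely many centres: it vanishes within
distance `δ` of them, and its energy density decays exponentially away from them. -/
theorem exists_phaseField {ι : Type*} (s : Finset ι) (c : ι → ℝ) {δ ε : ℝ} (hε : 0 < ε) :
    ∃ v h : ℝ → ℝ, (∀ U, LocACOn v h U) ∧ (∀ x, 0 ≤ v x ∧ v x ≤ 1) ∧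
      (∀ i ∈ s, ∀ x, |x - c i| ≤ δ → v x = 0) ∧
      (∀ x, 1 - v x ≤ ∑ i ∈ s, Real.exp ((δ - |x - c i|) / ε)) ∧
      ∀ x, ε / 2 * h x ^ 2 + 1 / (2 * ε) * (v x - 1) ^ 2 ≤
        ∑ i ∈ s, 1 / ε * Real.exp (2 * ((δ - |x - c i|) / ε)) := by
  rcases s.eq_empty_or_nonempty with rfl | hs
  · refine ⟨fun _ => 1, fun _ => 0, fun U a b _ _ => ⟨by simp, by simp⟩, by simp, by simp,
      by simp, by simp⟩
  set T : Set ℝ := c '' (s : Set ι) with hT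
  have hTc : IsCompact T := (s.finite_toSet.image c).isCompact
  have hTn : T.Nonempty := hs.to_set.image c
  set φ : ℝ → ℝ := fun x => max (Metric.infDist x T - δ) 0 with hφ
  have hφ0 (x) : 0 ≤ φ x := le_max_right _ _
  have hφL : LipschitzWith 1 φ := by
    have h := ((Metric.lipschitz_infDist_pt T).sub (LipschitzWith.const δ)).max_const 0
    simpa using h
  set v : ℝ → ℝ := fun x => 1 - Real.exp (-φ x / ε) with hv
  have hle (x) : ∃ i ∈ s, -φ x / ε ≤ (δ - |x - c i|) / ε := by
    obtain ⟨y, ⟨i, hi, rfl⟩, hd⟩ := hTc.exists_infDist_eq_dist hTn x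
    refine ⟨i, hi, ?_⟩
    have : Metric.infDist x T - δ ≤ φ x := le_max_left _ _
    rw [hd, Real.dist_eq] at this
    gcongr
    linarith
  have hvL : LipschitzWith (Real.toNNReal (1 / ε)) v := by
    refine LipschitzWith.of_le_add_mul _ fun x y => ?_
    rw [Real.coe_toNNReal _ (by positivity)]
    have h1 := hφL.le_add_mul x y
    have h2 := Real.add_one_le_exp (φ x / ε - φ y / ε)
    have h3 : Real.exp (-φ y / ε) =
        Real.exp (-φ x / ε) * Real.exp (φ x / ε - φ y / ε) := by
      rw [← Real.exp_add]; ring_nf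
    have h4 : Real.exp (-φ x / ε) ≤ 1 := Real.exp_le_one_iff.2 (by
      rw [neg_div]; have := div_nonneg (hφ0 x) hε.le; linarith)
    have h4' : Real.exp (-φ y / ε) ≤ 1 := Real.exp_le_one_iff.2 (by
      rw [neg_div]; have := div_nonneg (hφ0 y) hε.le; linarith)
    have h5 : φ x / ε - φ y / ε ≤ 1 / ε * dist x y := by
      rw [← sub_div, one_div, inv_mul_eq_div]
      gcongr
      simp at h1; linarith
    have h6 : 0 ≤ 1 / ε * dist x y := by positivity
    have h7 := Real.add_one_le_exp (φ y / ε - φ x / ε)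
    have h8 : Real.exp (-φ x / ε) =
        Real.exp (-φ y / ε) * Real.exp (φ y / ε - φ x / ε) := by
      rw [← Real.exp_add]; ring_nf
    simp only [hv]
    nlinarith [Real.exp_pos (-φ x / ε), Real.exp_pos (-φ y / ε)]
  have hderiv (x) : |deriv v x| ≤ Real.exp (-φ x / ε) / ε := by
    by_cases hd : DifferentiableAt ℝ v x
    · have hφd : DifferentiableAt ℝ φ x := by
        have : φ = fun x => -ε * Real.log (1 - v x) := by
          funext y
          simp only [hv, sub_sub_cancel, Real.log_exp]
          field_simp
        rw [this]
        refine DifferentiableAt.const_mul (DifferentiableAt.log ((differentiableAt_const _).sub hd)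
          ?_) _
        change 1 - v x ≠ 0
        simp only [hv, sub_sub_cancel]
        positivity
      have h1 : HasDerivAt v (-(Real.exp (-φ x / ε) * (-deriv φ x / ε))) x :=
        ((hφd.hasDerivAt.neg.div_const ε).exp).const_sub 1
      have h2 := norm_deriv_le_of_lipschitz (x₀ := x) hφL
      rw [h1.deriv, abs_neg, abs_mul, abs_div, abs_neg, abs_of_pos hε,
        abs_of_pos (Real.exp_pos _), ← mul_div_assoc]
      gcongr
      exact mul_le_of_le_one_right (Real.exp_pos _).le (by simpa using h2)
    · rw [deriv_zero_of_not_differentiableAt hd]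
      simp only [abs_zero]
      positivity
  refine ⟨v, deriv v, fun U => hvL.locACOn_deriv U, fun x => ⟨?_, ?_⟩, fun i hi x hx => ?_,
    fun x => ?_, fun x => ?_⟩
  · simp only [hv, sub_nonneg, Real.exp_le_one_iff, neg_div, neg_nonpos]
    exact div_nonneg (hφ0 x) hε.le
  · have := Real.exp_pos (-φ x / ε)
    simp only [hv]; linarith
  · have h1 : Metric.infDist x T ≤ dist x (c i) :=
      Metric.infDist_le_dist_of_mem ⟨i, hi, rfl⟩
    rw [Real.dist_eq] at h1
    have : φ x = 0 := max_eq_right (by linarith)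
    simp [hv, this]
  · obtain ⟨i, hi, h⟩ := hle x
    simp only [hv, sub_sub_cancel]
    exact (Real.exp_le_exp.2 h).trans (Finset.single_le_sum
      (f := fun i => Real.exp ((δ - |x - c i|) / ε)) (fun j _ => (Real.exp_pos _).le) hi)
  · obtain ⟨i, hi, h⟩ := hle x
    have h1 := pow_le_pow_left₀ (abs_nonneg _) (hderiv x) 2
    rw [sq_abs] at h1
    calc _ ≤ ε / 2 * (Real.exp (-φ x / ε) / ε) ^ 2 +
          1 / (2 * ε) * Real.exp (-φ x / ε) ^ 2 := by
          have : (v x - 1) ^ 2 = Real.exp (-φ x / ε) ^ 2 := by simp only [hv]; ring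
          rw [this]
          gcongr
      _ = 1 / ε * Real.exp (2 * (-φ x / ε)) := by
          rw [two_mul (-φ x / ε), Real.exp_add]; field_simp; ring
      _ ≤ 1 / ε * Real.exp (2 * ((δ - |x - c i|) / ε)) := by gcongr
      _ ≤ _ := Finset.single_le_sum
          (f := fun i => 1 / ε * Real.exp (2 * ((δ - |x - c i|) / ε)))
          (fun j _ => by positivity) hi

/-- The increments of `f` over compact subintervals of `V` are the integrals of `g`. -/
def HasIncrementOn (f g : ℝ → ℝ) (V : Set ℝ) : Prop :=
  ∀ x y : ℝ, x ≤ y → Icc x y ⊆ V → f y - f x = ∫ t in x..y, g t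

theorem LocACOn.hasIncrementOn {f g : ℝ → ℝ} {V : Set ℝ} (h : LocACOn f g V) :
    HasIncrementOn f g V := fun x y hxy hV => by
  rw [(h x y hxy hV).2 y ⟨hxy, le_rfl⟩]
  ring

theorem IntegrableOn.intervalIntegrable_of_Icc_subset {g : ℝ → ℝ} {V : Set ℝ}
    (hg : IntegrableOn g V) {x y : ℝ} (hxy : x ≤ y) (hV : Icc x y ⊆ V) :
    IntervalIntegrable g volume x y :=
  (intervalIntegrable_iff_integrableOn_Icc_of_le hxy).2 (hg.mono_set hV)

theorem HasIncrementOn.locACOn {f g : ℝ → ℝ} {V : Set ℝ} (h : HasIncrementOn f g V)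
    (hg : IntegrableOn g V) : LocACOn f g V := fun a b hab hV =>
  ⟨IntegrableOn.intervalIntegrable_of_Icc_subset hg hab hV, fun x hx => by
    rw [← h a x hx.1 ((Icc_subset_Icc le_rfl hx.2).trans hV)]
    ring⟩

theorem HasIncrementOn.glue {f g : ℝ → ℝ} {V : Set ℝ} (hg : IntegrableOn g V) (a : ℝ)
    (hl : HasIncrementOn f g (V ∩ Iic a)) (hr : HasIncrementOn f g (V ∩ Ici a)) :
    HasIncrementOn f g V := by
  intro x y hxy hV
  rcases le_total y a with hy | hy
  · exact hl x y hxy fun z hz => ⟨hV hz, hz.2.trans hy⟩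
  rcases le_total a x with hx | hx
  · exact hr x y hxy fun z hz => ⟨hV hz, hx.trans hz.1⟩
  have h1 : Icc x a ⊆ V := (Icc_subset_Icc le_rfl hy).trans hV
  have h2 : Icc a y ⊆ V := (Icc_subset_Icc hx le_rfl).trans hV
  rw [← intervalIntegral.integral_add_adjacent_intervals
    (IntegrableOn.intervalIntegrable_of_Icc_subset hg hx h1)
    (IntegrableOn.intervalIntegrable_of_Icc_subset hg hy h2),
    ← hl x a hx fun z hz => ⟨h1 hz, hz.2⟩, ← hr a y hy fun z hz => ⟨h2 hz, hz.1⟩]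
  ring

theorem HasIncrementOn.of_const {f g : ℝ → ℝ} {V : Set ℝ} {k : ℝ}
    (hf : ∀ x ∈ V, ∀ y ∈ V, f y - f x = (y - x) * k) (hg : ∀ x ∈ interior V, g x = k) :
    HasIncrementOn f g V := by
  intro x y hxy hV
  rw [hf x (hV ⟨le_rfl, hxy⟩) y (hV ⟨hxy, le_rfl⟩), ← smul_eq_mul,
    ← intervalIntegral.integral_const]
  refine intervalIntegral.integral_congr_Ioo_of_le hxy fun t ht => (hg t ?_).symm
  exact interior_mono hV (by rwa [interior_Icc])

/-- Replaces a primitive with a jump at `x₀ ∈ [a, b]` by one that is constant on `[a, p]` and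
`[q, b]` and affine on `[p, q]`. -/
theorem HasIncrementOn.exists_bridge {f g : ℝ → ℝ} {V V' W : Set ℝ} {x₀ a p q b A B M : ℝ}
    (hf : HasIncrementOn f g V) (hg : IntegrableOn g W) (hV'W : V' ⊆ W)
    (hV' : V' ⊆ insert x₀ V) (hx₀ : x₀ ∈ Icc a b) (hap : a ≤ p) (hpq : p < q) (hqb : q ≤ b)
    (hA : ∀ x < a, Icc x a ⊆ V' → A - f x = ∫ t in x..a, g t)
    (hB : ∀ x > b, Icc b x ⊆ V' → f x - B = ∫ t in b..x, g t)
    (hAM : |A| ≤ M) (hBM : |B| ≤ M) :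
    ∃ F G : ℝ → ℝ, IntegrableOn G W ∧ HasIncrementOn F G V' ∧ (∀ x ∉ Icc a b, F x = f x) ∧
      (∀ x ∈ Icc a b, |F x| ≤ M) ∧ ∀ x ∉ Icc p q, G x ^ 2 ≤ g x ^ 2 := by
  set θ : ℝ → ℝ := fun x => max 0 (min 1 ((x - p) / (q - p))) with hθ
  set F : ℝ → ℝ := fun x => if x < a then f x else if x ≤ b then A + (B - A) * θ x else f x
    with hF
  set G : ℝ → ℝ := fun x => (Icc a b)ᶜ.indicator g x +
    (Icc p q).indicator (fun _ => (B - A) / (q - p)) x with hG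
  have hqp : 0 < q - p := sub_pos.2 hpq
  have hθp (x) (hx : x ≤ p) : θ x = 0 := by
    refine max_eq_left ((min_le_right _ _).trans ?_)
    exact div_nonpos_of_nonpos_of_nonneg (by linarith) hqp.le
  have hθq (x) (hx : q ≤ x) : θ x = 1 := by
    have : 1 ≤ (x - p) / (q - p) := (one_le_div hqp).2 (by linarith)
    simp [hθ, this]
  have hθm (x) (hx : x ∈ Icc p q) : θ x = (x - p) / (q - p) := by
    have h1 : (x - p) / (q - p) ≤ 1 := (div_le_one hqp).2 (by linarith [hx.2])
    have h0 : 0 ≤ (x - p) / (q - p) := div_nonneg (by linarith [hx.1]) hqp.le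
    simp [hθ, h0, h1]
  have hFm (x) (hx : x ∈ Icc a b) : F x = A + (B - A) * θ x := by
    simp [hF, not_lt.2 hx.1, hx.2]
  have hFo (x) (hx : x ∉ Icc a b) : F x = f x := by
    by_cases h : x < a
    · simp [hF, h]
    · have : ¬ x ≤ b := fun h' => hx ⟨not_lt.1 h, h'⟩
      simp [hF, h, this]
  have hGo (x) (hx : x ∉ Icc a b) : G x = g x := by
    have : x ∉ Icc p q := fun h => hx ⟨hap.trans h.1, h.2.trans hqb⟩
    simp only [hG, indicator_of_notMem this, indicator_of_mem (mem_compl hx), add_zero]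
  have hGm (x) (hx : x ∈ Icc a b) (hx' : x ∉ Icc p q) : G x = 0 := by
    simp only [hG, indicator_of_notMem hx', indicator_of_notMem (notMem_compl_iff.2 hx), add_zero]
  have hGc (x) (hx : x ∈ Icc p q) : G x = (B - A) / (q - p) := by
    have : x ∈ Icc a b := ⟨hap.trans hx.1, hx.2.trans hqb⟩
    simp only [hG, indicator_of_mem hx, indicator_of_notMem (notMem_compl_iff.2 this), zero_add]
  have hGi : IntegrableOn G W := by
    refine (hg.indicator measurableSet_Icc.compl).add ?_
    refine (integrable_indicator_iff measurableSet_Icc).2 ?_ |>.integrableOn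
    exact integrableOn_const (by simp)
  have hGV (Z : Set ℝ) : IntegrableOn G (V' ∩ Z) :=
    hGi.mono_set (inter_subset_left.trans hV'W)
  refine ⟨F, G, hGi, ?_, hFo, fun x hx => ?_, fun x hx => ?_⟩
  · refine .glue (hGi.mono_set hV'W) a (fun x y hxy hsub => ?_) (.glue (hGV _) b
      (.glue ((hGV _).mono_set inter_subset_left) p
        (.of_const (k := 0) (fun x hx y hy => ?_) fun x hx => ?_)
        (.glue (((hGV _).mono_set inter_subset_left).mono_set inter_subset_left) q
          (.of_const (k := (B - A) / (q - p)) (fun x hx y hy => ?_) fun x hx => ?_)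
          (.of_const (k := 0) (fun x hx y hy => ?_) fun x hx => ?_)))
      fun x y hxy hsub => ?_)
    · have hya : y ≤ a := (hsub ⟨hxy, le_rfl⟩).2
      have hint : ∫ t in x..y, G t = ∫ t in x..y, g t :=
        intervalIntegral.integral_congr_Ioo_of_le hxy fun t ht =>
          hGo t fun h => (ht.2.trans_le hya).not_ge h.1
      rw [hint]
      rcases hxy.eq_or_lt with rfl | hxy'
      · simp
      rw [hFo x fun h => (hxy'.trans_le hya).not_ge h.1]
      rcases hya.eq_or_lt with rfl | hya'
      · rw [hFm y ⟨le_rfl, by linarith⟩, hθp y hap, mul_zero, add_zero]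
        exact hA x hxy' fun z hz => (hsub hz).1
      · rw [hFo y fun h => hya'.not_ge h.1]
        refine hf x y hxy fun z hz => (hV' (hsub hz).1).resolve_left ?_
        rintro rfl
        exact (hz.2.trans_lt hya').not_ge hx₀.1
    · have hx' := hx.1.1.2; have hy' := hy.1.1.2
      have hx2 := hx.2; have hy2 := hy.2
      simp only [mem_Ici, mem_Iic] at hx' hy' hx2 hy2
      rw [hFm x ⟨hx', by linarith⟩, hFm y ⟨hy', by linarith⟩, hθp x hx2, hθp y hy2]
      ring
    · have hx1 := interior_mono inter_subset_right hx
      have hx2 := (interior_subset hx).1.1.2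
      rw [interior_Iic] at hx1
      exact hGm x ⟨hx2, by linarith [mem_Iio.1 hx1]⟩ fun h => (mem_Iio.1 hx1).not_ge h.1
    · have hx2 := hx.2; have hy2 := hy.2
      have hx3 := hx.1.2; have hy3 := hy.1.2
      simp only [mem_Ici, mem_Iic] at hx2 hy2 hx3 hy3
      rw [hFm x ⟨by linarith, by linarith⟩, hFm y ⟨by linarith, by linarith⟩, hθm x ⟨hx3, hx2⟩,
        hθm y ⟨hy3, hy2⟩]
      ring
    · have := interior_subset hx
      exact hGc x ⟨this.1.2, this.2⟩
    · have hx2 := hx.2; have hy2 := hy.2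
      have hx3 := hx.1.1.2; have hy3 := hy.1.1.2
      simp only [mem_Ici, mem_Iic] at hx2 hy2 hx3 hy3
      rw [hFm x ⟨by linarith, by linarith⟩, hFm y ⟨by linarith, by linarith⟩, hθq x hx2,
        hθq y hy2]
      ring
    · have hx1 := interior_mono inter_subset_right hx
      have hx2 := (interior_subset hx).1.1.2
      have hx3 := (interior_subset hx).1.1.1.2
      rw [interior_Ici] at hx1
      exact hGm x ⟨hx3, hx2⟩ fun h => (mem_Ioi.1 hx1).not_ge h.2
    · have hbx : b ≤ x := (hsub ⟨le_rfl, hxy⟩).2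
      have hint : ∫ t in x..y, G t = ∫ t in x..y, g t :=
        intervalIntegral.integral_congr_Ioo_of_le hxy fun t ht =>
          hGo t fun h => (hbx.trans_lt ht.1).not_ge h.2
      rw [hint]
      rcases hxy.eq_or_lt with rfl | hxy'
      · simp
      rw [hFo y fun h => (hbx.trans_lt hxy').not_ge h.2]
      rcases hbx.eq_or_lt with rfl | hbx'
      · rw [hFm b ⟨by linarith, le_rfl⟩, hθq b hqb, mul_one, add_sub_cancel]
        exact hB y hxy' fun z hz => (hsub hz).1.1
      · rw [hFo x fun h => hbx'.not_ge h.2]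
        refine hf x y hxy fun z hz => (hV' (hsub hz).1.1).resolve_left ?_
        rintro rfl
        exact (hbx'.trans_le hz.1).not_ge hx₀.2
  · have h0 : 0 ≤ θ x := le_max_left _ _
    have h1 : θ x ≤ 1 := max_le zero_le_one (min_le_left _ _)
    rw [hFm x hx]
    rw [abs_le] at *
    constructor <;> nlinarith
  · by_cases h : x ∈ Icc a b
    · rw [hGm x h hx]; simpa using sq_nonneg (g x)
    · rw [hGo x h]

theorem HasIncrementOn.sub_eq_of_tendsto_left {f g : ℝ → ℝ} {V : Set ℝ} {x a A : ℝ}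
    (hf : HasIncrementOn f g V) (hxa : x < a) (hV : Ico x a ⊆ V) (hg : IntegrableOn g (Icc x a))
    (hA : Tendsto f (nhdsWithin a (Iio a)) (nhds A)) : A - f x = ∫ t in x..a, g t := by
  have hle : nhdsWithin a (Ico x a) = nhdsWithin a (Iio a) := nhdsWithin_Ico_eq_nhdsLT hxa
  have h1 : Tendsto (fun y => f y - f x) (nhdsWithin a (Ico x a)) (nhds (A - f x)) := by
    rw [hle]; exact hA.sub_const _
  have h2 : Tendsto (fun y => ∫ t in x..y, g t) (nhdsWithin a (Ico x a))
      (nhds (∫ t in x..a, g t)) := by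
    have h := intervalIntegral.continuousOn_primitive_interval (a := x) (b := a)
      (by rwa [uIcc_of_le hxa.le])
    rw [uIcc_of_le hxa.le] at h
    exact (h a ⟨hxa.le, le_rfl⟩).mono_left (nhdsWithin_mono _ Ico_subset_Icc_self)
  have : (nhdsWithin a (Ico x a)).NeBot := by rw [hle]; infer_instance
  refine tendsto_nhds_unique (h1.congr' ?_) h2
  filter_upwards [self_mem_nhdsWithin] with y hy
  exact hf x y hy.1 fun z hz => hV ⟨hz.1, hz.2.trans_lt hy.2⟩

theorem HasIncrementOn.sub_eq_of_tendsto_right {f g : ℝ → ℝ} {V : Set ℝ} {x b B : ℝ}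
    (hf : HasIncrementOn f g V) (hbx : b < x) (hV : Ioc b x ⊆ V) (hg : IntegrableOn g (Icc b x))
    (hB : Tendsto f (nhdsWithin b (Ioi b)) (nhds B)) : f x - B = ∫ t in b..x, g t := by
  have hle : nhdsWithin b (Ioc b x) = nhdsWithin b (Ioi b) := nhdsWithin_Ioc_eq_nhdsGT hbx
  have h1 : Tendsto (fun y => f x - f y) (nhdsWithin b (Ioc b x)) (nhds (f x - B)) := by
    rw [hle]; exact hB.const_sub _
  have h2 : Tendsto (fun y => ∫ t in y..x, g t) (nhdsWithin b (Ioc b x))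
      (nhds (∫ t in b..x, g t)) := by
    have h := intervalIntegral.continuousOn_primitive_interval_left (a := b) (b := x)
      (by rwa [uIcc_of_le hbx.le])
    rw [uIcc_of_le hbx.le] at h
    exact (h b ⟨le_rfl, hbx.le⟩).mono_left (nhdsWithin_mono _ Ioc_subset_Icc_self)
  have : (nhdsWithin b (Ioc b x)).NeBot := by rw [hle]; infer_instance
  refine tendsto_nhds_unique (h1.congr' ?_) h2
  filter_upwards [self_mem_nhdsWithin] with y hy
  exact hf y x hy.2 fun z hz => hV ⟨hy.1.trans_le hz.1, hz.2⟩

/-- Moves the jumps of `u` at the points `x ∈ T` to affine transitions on the intervals of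
radius `δ` around `c x`. -/
theorem HasIncrementOn.exists_fill_jumps {u u' : ℝ → ℝ} {W : Set ℝ} {S : Finset ℝ} {M δ ρ : ℝ}
    {c : ℝ → ℝ} (hu : HasIncrementOn u u' (W \ S)) (hu' : IntegrableOn u' W)
    (hM : ∀ x ∈ W, |u x| ≤ M)
    (hjump : ∀ x ∈ S, ∃ l r : ℝ, Tendsto u (nhdsWithin x (Iio x)) (nhds l) ∧
      Tendsto u (nhdsWithin x (Ioi x)) (nhds r))
    (hδ : 0 < δ) (hδρ : δ < ρ) (hc : ∀ x ∈ S, c x = x - ρ ∨ c x = x + ρ)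
    (hSW : ∀ x ∈ S, Icc (x - 2 * ρ) (x + 2 * ρ) ⊆ W)
    (hsep : ∀ x ∈ S, ∀ y ∈ S, x ≠ y → 4 * ρ < |x - y|) (T : Finset ℝ) (hTS : T ⊆ S) :
    ∃ F G : ℝ → ℝ, IntegrableOn G W ∧ HasIncrementOn F G (W \ ↑(S \ T)) ∧
      (∀ x ∈ W, |F x| ≤ M) ∧
      (∀ x, (∀ i ∈ T, x ∉ Icc (i - 2 * ρ) (i + 2 * ρ)) → F x = u x) ∧
      ∀ x, (∀ i ∈ T, δ < |x - c i|) → G x ^ 2 ≤ u' x ^ 2 := by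
  induction T using Finset.induction_on with
  | empty => exact ⟨u, u', hu', by simpa using hu, hM, by simp, by simp⟩
  | insert x₀ T hx₀T ih =>
    have hx₀ : x₀ ∈ S := hTS (Finset.mem_insert_self _ _)
    obtain ⟨F, G, hG, hFG, hFM, hFu, hGu⟩ := ih ((Finset.subset_insert _ _).trans hTS)
    obtain ⟨l, r, hl, hr⟩ := hjump x₀ hx₀
    have hnear (x) (hx : x ∈ Icc (x₀ - 2 * ρ) (x₀ + 2 * ρ)) : F x = u x := by
      refine hFu x fun i hi h => ?_
      have h1 := hsep x₀ hx₀ i (hTS (Finset.mem_insert_of_mem hi))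
        fun h => hx₀T (h ▸ hi)
      have : |x₀ - i| ≤ 4 * ρ := abs_le.2 ⟨by linarith [hx.2, h.1], by linarith [hx.1, h.2]⟩
      linarith
    have hnhds : Icc (x₀ - 2 * ρ) (x₀ + 2 * ρ) ∈ nhds x₀ :=
      Icc_mem_nhds (by linarith) (by linarith)
    have hFl : Tendsto F (nhdsWithin x₀ (Iio x₀)) (nhds l) := hl.congr' (by
      filter_upwards [mem_nhdsWithin_of_mem_nhds hnhds] with x hx using (hnear x hx).symm)
    have hFr : Tendsto F (nhdsWithin x₀ (Ioi x₀)) (nhds r) := hr.congr' (by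
      filter_upwards [mem_nhdsWithin_of_mem_nhds hnhds] with x hx using (hnear x hx).symm)
    have hlM : |l| ≤ M := le_of_tendsto hFl.abs (by
      filter_upwards [mem_nhdsWithin_of_mem_nhds hnhds] with x hx using hFM x (hSW x₀ hx₀ hx))
    have hrM : |r| ≤ M := le_of_tendsto hFr.abs (by
      filter_upwards [mem_nhdsWithin_of_mem_nhds hnhds] with x hx using hFM x (hSW x₀ hx₀ hx))
    set V := W \ (↑(S \ T) : Set ℝ) with hV
    set V' := W \ (↑(S \ insert x₀ T) : Set ℝ) with hV'
    have hsub : V' ⊆ insert x₀ V := by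
      intro x hx
      simp only [hV', hV, Set.mem_sdiff, mem_insert_iff, Finset.mem_coe, Finset.mem_sdiff,
        Finset.mem_insert] at hx ⊢
      tauto
    have hsub' {x : ℝ} (hx : x ∈ V') (h : x ≠ x₀) : x ∈ V := (hsub hx).resolve_left h
    have hV'W : V' ⊆ W := sdiff_subset
    suffices ∃ F' G' : ℝ → ℝ, IntegrableOn G' W ∧ HasIncrementOn F' G' V' ∧
        (∀ x ∉ Icc (x₀ - 2 * ρ) (x₀ + 2 * ρ), F' x = F x) ∧ (∀ x ∈ W, |F' x| ≤ M) ∧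
        ∀ x ∉ Icc (c x₀ - δ) (c x₀ + δ), G' x ^ 2 ≤ G x ^ 2 by
      obtain ⟨F', G', h1, h2, h3, h4, h5⟩ := this
      refine ⟨F', G', h1, h2, h4, fun x hx => ?_, fun x hx => ?_⟩
      · rw [h3 x (hx x₀ (Finset.mem_insert_self _ _)),
          hFu x fun i hi => hx i (Finset.mem_insert_of_mem hi)]
      · refine (h5 x fun h => ?_).trans (hGu x fun i hi => hx i (Finset.mem_insert_of_mem hi))
        refine (hx x₀ (Finset.mem_insert_self _ _)).not_ge (abs_le.2 ?_)
        exact ⟨by linarith [h.1], by linarith [h.2]⟩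
    rcases hc x₀ hx₀ with hc | hc
    · have hp : c x₀ - δ ∈ Icc (x₀ - 2 * ρ) (x₀ + 2 * ρ) := ⟨by linarith, by linarith⟩
      obtain ⟨F', G', h1, h2, h3, h4, h5⟩ := hFG.exists_bridge (V' := V') (x₀ := x₀)
        (a := c x₀ - δ) (p := c x₀ - δ) (q := c x₀ + δ) (b := x₀) (A := F (c x₀ - δ)) (B := r)
        (M := M) hG hV'W hsub ⟨by linarith, le_rfl⟩ le_rfl (by linarith) (by linarith)
        (fun x hx h => hFG _ _ hx.le fun z hz => hsub' (h hz) (by linarith [hz.2]))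
        (fun x hx h => hFG.sub_eq_of_tendsto_right hx
          (fun z hz => hsub' (h ⟨hz.1.le, hz.2⟩) hz.1.ne')
          (hG.mono_set (h.trans hV'W)) hFr) (hFM _ (hSW x₀ hx₀ hp)) hrM
      refine ⟨F', G', h1, h2, fun x hx => h3 x fun h => hx ?_, fun x hx => ?_, h5⟩
      · exact ⟨by linarith [h.1], by linarith [h.2]⟩
      · by_cases h : x ∈ Icc (c x₀ - δ) x₀
        · exact h4 x h
        · rw [h3 x h]; exact hFM x hx
    · have hp : c x₀ + δ ∈ Icc (x₀ - 2 * ρ) (x₀ + 2 * ρ) := ⟨by linarith, by linarith⟩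
      obtain ⟨F', G', h1, h2, h3, h4, h5⟩ := hFG.exists_bridge (V' := V') (x₀ := x₀)
        (a := x₀) (p := c x₀ - δ) (q := c x₀ + δ) (b := c x₀ + δ) (A := l) (B := F (c x₀ + δ))
        (M := M) hG hV'W hsub ⟨le_rfl, by linarith⟩ (by linarith) (by linarith) le_rfl
        (fun x hx h => hFG.sub_eq_of_tendsto_left hx
          (fun z hz => hsub' (h ⟨hz.1, hz.2.le⟩) hz.2.ne)
          (hG.mono_set (h.trans hV'W)) hFl)
        (fun x hx h => hFG _ _ hx.le fun z hz => hsub' (h hz) (by linarith [hz.1]))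
        hlM (hFM _ (hSW x₀ hx₀ hp))
      refine ⟨F', G', h1, h2, fun x hx => h3 x fun h => hx ?_, fun x hx => ?_, h5⟩
      · exact ⟨by linarith [h.1], by linarith [h.2]⟩
      · by_cases h : x ∈ Icc x₀ (c x₀ + δ)
        · exact h4 x h
        · rw [h3 x h]; exact hFM x hx

theorem LocACOn.integrableOn_of_weighted_sq {u u' ω : ℝ → ℝ} {W S : Set ℝ} (hW : IsOpen W)
    (hWfin : volume W < ⊤) (hS : S.Finite) (hu : LocACOn u u' (W \ S))
    (hω : ∀ x ∈ W, 1 ≤ ω x)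
    (hfin : (∫⁻ x in W, ENNReal.ofReal ((u' x) ^ 2 * ω x)) < ⊤) : IntegrableOn u' W := by
  have hopen : IsOpen (W \ S) := hW.sdiff hS.isClosed
  have hloc : LocallyIntegrableOn u' (W \ S) := by
    intro x hx
    obtain ⟨r, hr, hsub⟩ := Metric.nhds_basis_closedBall.mem_iff.1 (hopen.mem_nhds hx)
    refine ⟨Metric.closedBall x r,
      mem_nhdsWithin_of_mem_nhds (Metric.closedBall_mem_nhds x hr), ?_⟩
    rw [Real.closedBall_eq_Icc] at hsub ⊢
    have hle : x - r ≤ x + r := by linarith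
    exact (intervalIntegrable_iff_integrableOn_Icc_of_le hle).1 (hu _ _ hle hsub).1
  have hmeas : AEStronglyMeasurable u' (volume.restrict W) := by
    rw [← Measure.restrict_congr_set (sdiff_null_ae_eq_self (hS.measure_zero volume))]
    exact hloc.aestronglyMeasurable
  refine ⟨hmeas, ?_⟩
  calc ∫⁻ x in W, ‖u' x‖ₑ
      ≤ ∫⁻ x in W, (1 + ENNReal.ofReal ((u' x) ^ 2 * ω x)) := by
        refine setLIntegral_mono' hW.measurableSet fun x hx => ?_
        rw [← ENNReal.ofReal_one, ← ENNReal.ofReal_add zero_le_one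
          (mul_nonneg (sq_nonneg _) (zero_le_one.trans (hω x hx))), Real.enorm_eq_ofReal_abs]
        refine ENNReal.ofReal_le_ofReal ?_
        have h1 : u' x ^ 2 * 1 ≤ u' x ^ 2 * ω x := by gcongr; exact hω x hx
        nlinarith [sq_nonneg (|u' x| - 1), sq_abs (u' x)]
    _ = volume W + ∫⁻ x in W, ENNReal.ofReal ((u' x) ^ 2 * ω x) := by
        rw [lintegral_add_left measurable_const]; simp
    _ < ⊤ := ENNReal.add_lt_top.2 ⟨hWfin, hfin⟩

theorem lintegral_sum_exp_le {ι : Type*} (s : Finset ι) (c : ι → ℝ) {δ ε : ℝ} (hε : 0 < ε)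
    (W : Set ℝ) :
    ∫⁻ x in W, ENNReal.ofReal (∑ i ∈ s, Real.exp ((δ - |x - c i|) / ε)) ≤
      ∑ _i ∈ s, ENNReal.ofReal (Real.exp (δ / ε) * (2 * ε)) := by
  refine (setLIntegral_le_lintegral _ _).trans ?_
  simp_rw [ENNReal.ofReal_sum_of_nonneg fun i _ => (Real.exp_pos _).le]
  rw [lintegral_finsetSum _ fun i _ => by fun_prop]
  refine Finset.sum_le_sum fun i _ => ?_
  have h (x : ℝ) : ENNReal.ofReal (Real.exp ((δ - |x - c i|) / ε)) =
      ENNReal.ofReal (Real.exp (δ / ε)) * ENNReal.ofReal (Real.exp (-(1 / ε) * |x - c i|)) := by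
    rw [← ENNReal.ofReal_mul (Real.exp_pos _).le, ← Real.exp_add]
    congr 2
    ring
  simp_rw [h]
  rw [lintegral_const_mul _ (by fun_prop), lintegral_exp_neg_mul_abs_sub (by positivity),
    ← ENNReal.ofReal_mul (Real.exp_pos _).le, div_div_eq_mul_div, div_one]

theorem lintegral_sum_exp_mul_weight_le {ι : Type*} (s : Finset ι) (c m : ι → ℝ)
    {C δ ε ρ : ℝ} (hε : 0 < ε) {W : Set ℝ} (hW : MeasurableSet W) {ω : ℝ → ℝ}
    (hω : ∀ x ∈ W, 0 ≤ ω x ∧ ω x ≤ C)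
    (hm : ∀ i ∈ s, ∀ x ∈ W, |x - c i| < ρ → ω x ≤ m i) :
    ∫⁻ x in W, ENNReal.ofReal
        ((∑ i ∈ s, 1 / ε * Real.exp (2 * ((δ - |x - c i|) / ε))) * ω x) ≤
      ∑ i ∈ s, (ENNReal.ofReal (Real.exp (2 * (δ / ε)) * m i) +
        ENNReal.ofReal (1 / ε * Real.exp (2 * ((δ - ρ) / ε)) * C) * volume W) := by
  set A : ι → ENNReal := fun i => ENNReal.ofReal (1 / ε * Real.exp (2 * (δ / ε)) * m i) with hA
  set T : ENNReal := ENNReal.ofReal (1 / ε * Real.exp (2 * ((δ - ρ) / ε)) * C) with hT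
  have hpt : ∀ x ∈ W, ENNReal.ofReal
      ((∑ i ∈ s, 1 / ε * Real.exp (2 * ((δ - |x - c i|) / ε))) * ω x) ≤
        ∑ i ∈ s, (ENNReal.ofReal (Real.exp (-(2 / ε) * |x - c i|)) * A i + T) := by
    intro x hx
    obtain ⟨h0, hC'⟩ := hω x hx
    have hC : 0 ≤ C := h0.trans hC'
    rw [Finset.sum_mul, ENNReal.ofReal_sum_of_nonneg fun i _ => by positivity]
    refine Finset.sum_le_sum fun i hi => ?_
    rcases lt_or_ge |x - c i| ρ with h | h
    · refine le_add_right ?_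
      rw [hA, ← ENNReal.ofReal_mul (Real.exp_pos _).le]
      refine ENNReal.ofReal_le_ofReal ?_
      calc _ ≤ 1 / ε * Real.exp (2 * ((δ - |x - c i|) / ε)) * m i := by
            gcongr; exact hm i hi x hx h
        _ = _ := by
            rw [show 2 * ((δ - |x - c i|) / ε) = -(2 / ε) * |x - c i| + 2 * (δ / ε) by ring,
              Real.exp_add]
            ring
    · refine le_add_left (ENNReal.ofReal_le_ofReal ?_)
      gcongr
  refine (setLIntegral_mono' hW hpt).trans ?_
  rw [lintegral_finsetSum _ fun i _ => by fun_prop]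
  refine Finset.sum_le_sum fun i _ => ?_
  rw [lintegral_add_right _ measurable_const, setLIntegral_const]
  gcongr
  refine (setLIntegral_le_lintegral _ _).trans ?_
  rw [lintegral_mul_const _ (by fun_prop), lintegral_exp_neg_mul_abs_sub (by positivity), hA,
    ← ENNReal.ofReal_mul (by positivity)]
  refine ENNReal.ofReal_le_ofReal (le_of_eq ?_)
  field_simp

theorem sum_ofReal_div_card_add_one_le {ι : Type*} (s : Finset ι) {η : ℝ} (hη : 0 ≤ η) :
    ∑ _i ∈ s, ENNReal.ofReal (η / (s.card + 1)) ≤ ENNReal.ofReal η := by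
  rw [← ENNReal.ofReal_sum_of_nonneg fun i _ => by positivity]
  refine ENNReal.ofReal_le_ofReal ?_
  rw [Finset.sum_const, nsmul_eq_mul, mul_div_assoc', div_le_iff₀ (by positivity)]
  nlinarith

theorem exists_tendsto_zero_of_forall_eventually {P : ℕ → ℝ → Prop}
    (h : ∀ η > 0, ∀ᶠ n in atTop, P n η) :
    ∃ η : ℕ → ℝ, Tendsto η atTop (nhds 0) ∧ ∀ᶠ n in atTop, P n (η n) := by
  classical
  have hk (k : ℕ) : ∀ᶠ n in atTop, P n (1 / ((k : ℝ) + 1)) := h _ (by positivity)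
  set K : ℕ → ℕ := fun n => Nat.findGreatest (fun k => P n (1 / ((k : ℝ) + 1))) n
  refine ⟨fun n => 1 / ((K n : ℝ) + 1),
    tendsto_one_div_add_atTop_nhds_zero_nat.comp (tendsto_atTop.2 fun k => ?_), ?_⟩
  · filter_upwards [hk k, eventually_ge_atTop k] with n hn hkn
    exact Nat.le_findGreatest hkn hn
  · filter_upwards [hk 0] with n hn
    exact Nat.findGreatest_spec (P := fun k : ℕ => P n (1 / ((k : ℝ) + 1))) (Nat.zero_le n) hn

theorem tendsto_phaseField_tail {ρ : ℝ} (hρ : 0 < ρ) (C : ℝ) :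
    Tendsto (fun ε : ℝ => 1 / ε * Real.exp (2 * ((ε ^ 2 - ρ) / ε)) * C)
      (nhdsWithin 0 (Ioi 0)) (nhds 0) := by
  have h1 : Tendsto (fun ε : ℝ => Real.exp (2 * ε) * C) (nhdsWithin 0 (Ioi 0))
      (nhds (Real.exp (2 * 0) * C)) :=
    (Continuous.tendsto (by fun_prop) _).mono_left nhdsWithin_le_nhds
  have h2 := (tendsto_rpow_mul_exp_neg_mul_atTop_nhds_zero 1 (2 * ρ) (by positivity)).comp
    (tendsto_inv_nhdsGT_zero (𝕜 := ℝ))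
  have h3 := h2.mul h1
  rw [zero_mul] at h3
  refine h3.congr' ?_
  filter_upwards [self_mem_nhdsWithin] with ε hε
  have hε' : ε ≠ 0 := (mem_Ioi.1 hε).ne'
  rw [show 2 * ((ε ^ 2 - ρ) / ε) = -(2 * ρ) * ε⁻¹ + 2 * ε by field_simp; ring, Real.exp_add]
  simp only [Function.comp, Real.rpow_one]
  ring

theorem eventually_weight_le_of_tendsto {ω : ℝ → ℝ} {x l r κ : ℝ} (hκ : 0 < κ)
    (hl : Tendsto ω (nhdsWithin x (Iio x)) (nhds l))
    (hr : Tendsto ω (nhdsWithin x (Ioi x)) (nhds r)) :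
    ∀ᶠ ρ in nhdsWithin (0 : ℝ) (Ioi 0), ∀ y, |y - (if l ≤ r then x - ρ else x + ρ)| < ρ →
      ω y ≤ min l r + κ := by
  split_ifs with h
  · rw [min_eq_left h]
    obtain ⟨a, ha, hsub⟩ := (mem_nhdsLT_iff_exists_Ioo_subset).1
      (hl.eventually (eventually_le_nhds (lt_add_of_pos_right l hκ)))
    filter_upwards [Ioo_mem_nhdsGT (show 0 < (x - a) / 2 by have := mem_Iio.1 ha; linarith)]
      with ρ hρ y hy
    rw [abs_lt] at hy
    exact hsub ⟨by linarith [hρ.2], by linarith⟩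
  · rw [min_eq_right (not_le.1 h).le]
    obtain ⟨a, ha, hsub⟩ := (mem_nhdsGT_iff_exists_Ioo_subset).1
      (hr.eventually (eventually_le_nhds (lt_add_of_pos_right r hκ)))
    filter_upwards [Ioo_mem_nhdsGT (show 0 < (a - x) / 2 by have := mem_Ioi.1 ha; linarith)]
      with ρ hρ y hy
    rw [abs_lt] at hy
    exact hsub ⟨by linarith, by linarith [hρ.2]⟩

/-- For every small `ε` there is a competitor whose two `L¹` errors and excess energy are at most
`η`. -/
theorem eventually_exists_almost_recovery {C : ℝ} {ω : ℝ → ℝ}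
    (hω1 : ∀ x ∈ Ioo (-1 : ℝ) 1, 1 ≤ ω x ∧ ω x ≤ C) {ωl ωr : ℝ → ℝ}
    (hωlim : ∀ x ∈ Ioo (-1 : ℝ) 1, Tendsto ω (nhdsWithin x (Iio x)) (nhds (ωl x)) ∧
      Tendsto ω (nhdsWithin x (Ioi x)) (nhds (ωr x)))
    {S : Finset ℝ} (hSI : (S : Set ℝ) ⊆ Ioo (-1 : ℝ) 1) {u u' : ℝ → ℝ} {M : ℝ}
    (hM : ∀ x ∈ Ioo (-1 : ℝ) 1, |u x| ≤ M) (hu : LocACOn u u' (Ioo (-1 : ℝ) 1 \ S))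
    (hfin : (∫⁻ x in Ioo (-1 : ℝ) 1, ENNReal.ofReal ((u' x) ^ 2 * ω x)) < ⊤)
    (hjump : ∀ x ∈ S, ∃ l r : ℝ, Tendsto u (nhdsWithin x (Iio x)) (nhds l) ∧
      Tendsto u (nhdsWithin x (Ioi x)) (nhds r)) {η : ℝ} (hη : 0 < η) :
    ∀ᶠ ε in nhdsWithin (0 : ℝ) (Ioi 0), ∃ F G v h : ℝ → ℝ,
      LocACOn F G (Ioo (-1 : ℝ) 1) ∧ LocACOn v h (Ioo (-1 : ℝ) 1) ∧
      (∀ x, 0 ≤ v x ∧ v x ≤ 1) ∧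
      (∫⁻ x in Ioo (-1 : ℝ) 1, ENNReal.ofReal (|F x - u x| * ω x)) ≤ ENNReal.ofReal η ∧
      (∫⁻ x in Ioo (-1 : ℝ) 1, ENNReal.ofReal |v x - 1|) ≤ ENNReal.ofReal η ∧
      (∫⁻ x in Ioo (-1 : ℝ) 1, ENNReal.ofReal ((v x) ^ 2 * (G x) ^ 2 * ω x)) +
          (∫⁻ x in Ioo (-1 : ℝ) 1, ENNReal.ofReal
            ((ε / 2 * h x ^ 2 + 1 / (2 * ε) * (v x - 1) ^ 2) * ω x)) ≤
        (∫⁻ x in Ioo (-1 : ℝ) 1, ENNReal.ofReal ((u' x) ^ 2 * ω x)) +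
          ∑ x ∈ S, ENNReal.ofReal (min (ωl x) (ωr x)) + ENNReal.ofReal η := by
  have hω0 : ∀ x ∈ Ioo (-1 : ℝ) 1, 0 ≤ ω x ∧ ω x ≤ C := fun x hx =>
    ⟨zero_le_one.trans (hω1 x hx).1, (hω1 x hx).2⟩
  set η' : ℝ := η / (S.card + 1) with hη'
  have hη'0 : 0 < η' := by positivity
  set κ : ℝ := η' / 3 with hκ
  have hκ0 : 0 < κ := by positivity
  have hlim0 {f : ℝ → ℝ} (hf : Continuous f) : Tendsto f (nhdsWithin 0 (Ioi 0)) (nhds (f 0)) :=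
    (hf.tendsto 0).mono_left nhdsWithin_le_nhds
  have hsmall {f : ℝ → ℝ} (hf : Continuous f) {k : ℝ} (hk : f 0 < k) :
      ∀ᶠ ρ in nhdsWithin (0 : ℝ) (Ioi 0), f ρ < k := (hlim0 hf).eventually (gt_mem_nhds hk)
  obtain ⟨ρ, hρ0, hρweight, hρW, hρsep, hρM⟩ : ∃ ρ : ℝ, 0 < ρ ∧
      (∀ x ∈ S, ∀ y, |y - (if ωl x ≤ ωr x then x - ρ else x + ρ)| < ρ →
        ω y ≤ min (ωl x) (ωr x) + κ) ∧
      (∀ x ∈ S, -1 < x - 2 * ρ ∧ x + 2 * ρ < 1) ∧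
      (∀ x ∈ S, ∀ y ∈ S, x ≠ y → 4 * ρ < |x - y|) ∧ 2 * M * C * (4 * ρ) < η' := by
    have h1 : ∀ᶠ ρ in nhdsWithin (0 : ℝ) (Ioi 0), ∀ x ∈ S, ∀ y,
        |y - (if ωl x ≤ ωr x then x - ρ else x + ρ)| < ρ → ω y ≤ min (ωl x) (ωr x) + κ :=
      (eventually_all_finset S).2 fun x hx => eventually_weight_le_of_tendsto hκ0
        (hωlim x (hSI hx)).1 (hωlim x (hSI hx)).2
    have h2 : ∀ᶠ ρ in nhdsWithin (0 : ℝ) (Ioi 0), ∀ x ∈ S, -1 < x - 2 * ρ ∧ x + 2 * ρ < 1 := by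
      refine (eventually_all_finset S).2 fun x hx => ?_
      filter_upwards [hsmall (f := fun ρ => 2 * ρ - x) (k := 1) (by fun_prop)
        (by linarith [(hSI hx).1]), hsmall (f := fun ρ => x + 2 * ρ) (k := 1) (by fun_prop)
        (by linarith [(hSI hx).2])] with ρ h h'
      exact ⟨by linarith, h'⟩
    have h3 : ∀ᶠ ρ in nhdsWithin (0 : ℝ) (Ioi 0), ∀ x ∈ S, ∀ y ∈ S, x ≠ y → 4 * ρ < |x - y| := by
      refine (eventually_all_finset S).2 fun x _ => (eventually_all_finset S).2 fun y _ => ?_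
      by_cases hxy : x = y
      · simp [hxy]
      · filter_upwards [hsmall (f := fun ρ => 4 * ρ) (k := |x - y|) (by fun_prop)
          (by simpa using sub_ne_zero.2 hxy)] with ρ h _ using h
    have h4 := hsmall (f := fun ρ => 2 * M * C * (4 * ρ)) (k := η') (by fun_prop) (by simpa)
    obtain ⟨ρ, a0, a1, a2, a3, a4⟩ := (eventually_mem_nhdsWithin.and
      (h1.and (h2.and (h3.and h4)))).exists
    exact ⟨ρ, a0, a1, a2, a3, a4⟩
  set c : ℝ → ℝ := fun x => if ωl x ≤ ωr x then x - ρ else x + ρ with hc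
  have hexp : ∀ᶠ ε in nhdsWithin (0 : ℝ) (Ioi 0), ∀ x ∈ S,
      Real.exp (2 * ε) * (min (ωl x) (ωr x) + κ) < min (ωl x) (ωr x) + 2 * κ :=
    (eventually_all_finset S).2 fun x _ => hsmall (by fun_prop) (by simp; linarith)
  filter_upwards [self_mem_nhdsWithin, hexp,
    hsmall (f := fun ε => ε ^ 2) (k := ρ) (by fun_prop) (by simpa),
    hsmall (f := fun ε => Real.exp ε * (2 * ε)) (k := η') (by fun_prop) (by simpa),
    (tendsto_phaseField_tail hρ0 C).eventually (gt_mem_nhds (half_pos hκ0))]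
    with ε hε hεexp hερ hεL hεtail
  have hε : 0 < ε := hε
  obtain ⟨v, h, hvh, hv01, hv0, hvL, hvE⟩ := exists_phaseField S c (δ := ε ^ 2) hε
  obtain ⟨F, G, hG, hFG, hFM, hFu, hGu⟩ := hu.hasIncrementOn.exists_fill_jumps (c := c)
    (LocACOn.integrableOn_of_weighted_sq isOpen_Ioo (by simp) S.finite_toSet hu
      (fun x hx => (hω1 x hx).1) hfin) hM hjump (by positivity) hερ
    (fun x _ => by simp only [hc]; split_ifs <;> simp)
    (fun x hx y hy => ⟨(hρW x hx).1.trans_le hy.1, hy.2.trans_lt (hρW x hx).2⟩) hρsep S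
    subset_rfl
  refine ⟨F, G, v, h, ?_, hvh _, hv01, ?_, ?_, ?_⟩
  · exact HasIncrementOn.locACOn (by simpa using hFG) hG
  · have hpt : ∀ x ∈ Ioo (-1 : ℝ) 1, ENNReal.ofReal (|F x - u x| * ω x) ≤
        ∑ i ∈ S, (Icc (i - 2 * ρ) (i + 2 * ρ)).indicator
          (fun _ => ENNReal.ofReal (2 * M * C)) x := by
      intro x hx
      by_cases hx' : ∀ i ∈ S, x ∉ Icc (i - 2 * ρ) (i + 2 * ρ)
      · simp [hFu x hx']
      · push Not at hx'
        obtain ⟨i, hi, hxi⟩ := hx'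
        refine le_trans ?_ (Finset.single_le_sum (fun _ _ => zero_le) hi)
        rw [indicator_of_mem hxi]
        have h1 := abs_sub (F x) (u x)
        have h2 := hFM x hx
        have h3 := hM x hx
        have h4 := hω0 x hx
        have h5 : |F x - u x| ≤ 2 * M := by linarith
        exact ENNReal.ofReal_le_ofReal (mul_le_mul h5 h4.2 h4.1 ((abs_nonneg _).trans h5))
    refine (setLIntegral_mono' measurableSet_Ioo hpt).trans ((setLIntegral_le_lintegral _ _).trans
      (le_trans ?_ (sum_ofReal_div_card_add_one_le S hη.le)))
    rw [lintegral_finsetSum _ fun i _ => measurable_const.indicator measurableSet_Icc]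
    refine Finset.sum_le_sum fun i _ => ?_
    rw [lintegral_indicator_const measurableSet_Icc, Real.volume_Icc,
      ← ENNReal.ofReal_mul' (by linarith)]
    refine ENNReal.ofReal_le_ofReal (le_trans (le_of_eq ?_) hρM.le)
    ring
  · refine le_trans (setLIntegral_mono' measurableSet_Ioo fun x _ => ?_)
      ((lintegral_sum_exp_le S c (δ := ε ^ 2) hε _).trans
        (le_trans ?_ (sum_ofReal_div_card_add_one_le S hη.le)))
    · rw [abs_sub_comm, abs_of_nonneg (by linarith [(hv01 x).2])]
      exact ENNReal.ofReal_le_ofReal (hvL x)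
    · refine Finset.sum_le_sum fun i _ => ENNReal.ofReal_le_ofReal ?_
      rw [pow_two, mul_self_div_self]
      exact hεL.le
  · rw [add_assoc]
    refine add_le_add (setLIntegral_mono' measurableSet_Ioo fun x hx => ?_) ?_
    · refine ENNReal.ofReal_le_ofReal (mul_le_mul_of_nonneg_right ?_ (hω0 x hx).1)
      by_cases hx' : ∀ i ∈ S, ε ^ 2 < |x - c i|
      · have h1 : v x ^ 2 ≤ 1 := pow_le_one₀ (hv01 x).1 (hv01 x).2
        exact (mul_le_of_le_one_left (sq_nonneg _) h1).trans (hGu x hx')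
      · push Not at hx'
        obtain ⟨i, hi, hxi⟩ := hx'
        rw [hv0 i hi x hxi]
        simpa using sq_nonneg (u' x)
    · refine le_trans (setLIntegral_mono' measurableSet_Ioo fun x hx => ?_)
        ((lintegral_sum_exp_mul_weight_le S c (fun i => min (ωl i) (ωr i) + κ) (δ := ε ^ 2)
          (ρ := ρ) hε measurableSet_Ioo hω0 fun i hi x _ hx => hρweight i hi x hx).trans ?_)
      · exact ENNReal.ofReal_le_ofReal (mul_le_mul_of_nonneg_right (hvE x) (hω0 x hx).1)
      · refine le_trans ?_ (add_le_add_right (sum_ofReal_div_card_add_one_le S hη.le) _)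
        rw [← Finset.sum_add_distrib]
        refine Finset.sum_le_sum fun i hi => ?_
        calc _ ≤ ENNReal.ofReal (min (ωl i) (ωr i) + 2 * κ) +
              ENNReal.ofReal (κ / 2) * ENNReal.ofReal 2 := by
              rw [Real.volume_Ioo, pow_two, mul_self_div_self, ← pow_two]
              gcongr
              · exact (hεexp i hi).le
              · norm_num
          _ ≤ ENNReal.ofReal (min (ωl i) (ωr i)) + ENNReal.ofReal (2 * κ) +
              ENNReal.ofReal κ := by
              rw [← ENNReal.ofReal_mul (by positivity), div_mul_cancel₀ _ two_ne_zero]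
              gcongr
              exact ENNReal.ofReal_add_le
          _ = _ := by
              rw [add_assoc, ← ENNReal.ofReal_add (by positivity) hκ0.le]
              congr 2
              rw [hκ]
              ring

/-- Γ-limsup (recovery sequence) inequality for the one-dimensional weighted
Ambrosio–Tortorelli functionals with an `SBV` weight `1 ≤ ω ≤ C` on `I = (-1, 1)`:
the jump energy in the limit only charges the lower trace `ω⁻(x) = min (ωl x) (ωr x)`. -/
theorem gamma_limsup_sbv_weight_1d
    (C : ℝ) (hC : 1 ≤ C)
    (ω : ℝ → ℝ)
    (hω1 : ∀ x ∈ Set.Ioo (-1 : ℝ) 1, 1 ≤ ω x ∧ ω x ≤ C)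
    (Sω : Set ℝ) (hSω : Sω.Finite) (hSωI : Sω ⊆ Set.Ioo (-1 : ℝ) 1)
    (hωc : ContinuousOn ω (Set.Ioo (-1 : ℝ) 1 \ Sω))
    (ωl ωr : ℝ → ℝ)
    (hωlim : ∀ x ∈ Set.Ioo (-1 : ℝ) 1,
      Tendsto ω (nhdsWithin x (Set.Iio x)) (nhds (ωl x)) ∧
      Tendsto ω (nhdsWithin x (Set.Ioi x)) (nhds (ωr x)))
    (S : Set ℝ) (hS : S.Finite) (hSI : S ⊆ Set.Ioo (-1 : ℝ) 1)
    (u u' : ℝ → ℝ)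
    (hubdd : ∃ M : ℝ, ∀ x ∈ Set.Ioo (-1 : ℝ) 1, |u x| ≤ M)
    (hu : LocACOn u u' (Set.Ioo (-1 : ℝ) 1 \ S))
    (hu'int : (∫⁻ x in Set.Ioo (-1 : ℝ) 1, ENNReal.ofReal ((u' x) ^ 2 * ω x)) < ⊤)
    (hjump : ∀ x ∈ S, ∃ l r : ℝ,
      Tendsto u (nhdsWithin x (Set.Iio x)) (nhds l) ∧
      Tendsto u (nhdsWithin x (Set.Ioi x)) (nhds r))
    (ε : ℕ → ℝ) (hεpos : ∀ n, 0 < ε n) (hε0 : Tendsto ε atTop (nhds 0)) :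
    ∃ un gn vn hn : ℕ → ℝ → ℝ,
      (∀ n, LocACOn (un n) (gn n) (Set.Ioo (-1 : ℝ) 1)) ∧
      (∀ n, LocACOn (vn n) (hn n) (Set.Ioo (-1 : ℝ) 1)) ∧
      (∀ n, ∀ x ∈ Set.Ioo (-1 : ℝ) 1, 0 ≤ vn n x ∧ vn n x ≤ 1) ∧
      Tendsto (fun n => ∫⁻ x in Set.Ioo (-1 : ℝ) 1,
        ENNReal.ofReal (|un n x - u x| * ω x)) atTop (nhds 0) ∧
      Tendsto (fun n => ∫⁻ x in Set.Ioo (-1 : ℝ) 1,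
        ENNReal.ofReal |vn n x - 1|) atTop (nhds 0) ∧
      Filter.limsup (fun n =>
          (∫⁻ x in Set.Ioo (-1 : ℝ) 1,
            ENNReal.ofReal ((vn n x) ^ 2 * (gn n x) ^ 2 * ω x)) +
          ∫⁻ x in Set.Ioo (-1 : ℝ) 1,
            ENNReal.ofReal (((ε n / 2) * (hn n x) ^ 2 +
              (1 / (2 * ε n)) * (vn n x - 1) ^ 2) * ω x)) atTop ≤
        (∫⁻ x in Set.Ioo (-1 : ℝ) 1, ENNReal.ofReal ((u' x) ^ 2 * ω x)) +
          ∑ x ∈ hS.toFinset, ENNReal.ofReal (min (ωl x) (ωr x)) := by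
  obtain ⟨M, hM⟩ := hubdd
  have hev : Tendsto ε atTop (nhdsWithin 0 (Ioi 0)) :=
    tendsto_nhdsWithin_iff.2 ⟨hε0, Eventually.of_forall hεpos⟩
  have hS' : (hS.toFinset : Set ℝ) = S := hS.coe_toFinset
  obtain ⟨η, hη, hP⟩ := exists_tendsto_zero_of_forall_eventually fun η' hη' =>
    hev.eventually (eventually_exists_almost_recovery hω1 hωlim (S := hS.toFinset)
      (by rwa [hS']) hM (by rwa [hS']) hu'int (by simpa using hjump) hη')
  obtain ⟨N, hN⟩ := eventually_atTop.1 hP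
  choose! un gn vn hn hun hvn hv01 hL1 hL2 hE using hN
  refine ⟨fun n => if N ≤ n then un n else 0, fun n => if N ≤ n then gn n else 0,
    fun n => if N ≤ n then vn n else 0, fun n => if N ≤ n then hn n else 0,
    fun n => ?_, fun n => ?_, fun n x _ => ?_, ?_, ?_, ?_⟩
  · by_cases h : N ≤ n
    · simpa only [if_pos h] using hun n h
    · exact fun a b _ _ => ⟨by simp only [if_neg h]; exact intervalIntegrable_const, by simp [h]⟩
  · by_cases h : N ≤ n
    · simpa only [if_pos h] using hvn n h
    · exact fun a b _ _ => ⟨by simp only [if_neg h]; exact intervalIntegrable_const, by simp [h]⟩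
  · by_cases h : N ≤ n
    · simpa only [if_pos h] using hv01 n h x
    · simp [h]
  · refine tendsto_of_tendsto_of_tendsto_of_le_of_le' tendsto_const_nhds
      (by simpa using ENNReal.tendsto_ofReal hη) (Eventually.of_forall fun _ => zero_le) ?_
    filter_upwards [eventually_ge_atTop N] with n h
    simpa only [if_pos h] using hL1 n h
  · refine tendsto_of_tendsto_of_tendsto_of_le_of_le' tendsto_const_nhds
      (by simpa using ENNReal.tendsto_ofReal hη) (Eventually.of_forall fun _ => zero_le) ?_
    filter_upwards [eventually_ge_atTop N] with n h
    simpa only [if_pos h] using hL2 n h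
  · have hlim := (ENNReal.tendsto_ofReal hη).const_add
      ((∫⁻ x in Ioo (-1 : ℝ) 1, ENNReal.ofReal ((u' x) ^ 2 * ω x)) +
        ∑ x ∈ hS.toFinset, ENNReal.ofReal (min (ωl x) (ωr x)))
    rw [ENNReal.ofReal_zero, add_zero] at hlim
    refine (limsup_le_limsup ?_).trans_eq hlim.limsup_eq
    filter_upwards [eventually_ge_atTop N] with n h
    simpa only [if_pos h] using hE n h
end
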